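/- In any 4-edge-colouring of the edges of the complete graph K_ℕ on vertex set ℕ, the supremum of d̄(P) over all monochromatic paths P is at least 1/3; equivalently, for every ε > 0 there exists a monochromatic path P with d̄(P) ≥ 1/3 − ε. -/

import Mathlib

open Filter

/-- Upper density of a set of positive integers:
`limsup_{n→∞} |A ∩ {1,…,n}| / n`. -/
noncomputable def upperDensity (A : Set ℕ+) : ℝ :=
  Filter.limsup (fun n : ℕ => (Nat.card {a : ℕ+ // a ∈ A ∧ (a : ℕ) ≤ n} : ℝ) / n) Filter.atTop

/-- Adjacency in the complete bipartite graph with parts `V` and `W`. -/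
def bipAdj (V W : Set ℕ+) (x y : ℕ+) : Prop :=
  (x ∈ V ∧ y ∈ W) ∨ (x ∈ W ∧ y ∈ V)

/-- Adjacency in the complete graph on the positive integers. -/
def completeAdj (x y : ℕ+) : Prop := x ≠ y

/-- `P` is the vertex set of a (finite or one-way infinite) path of colour `i`
in the graph with adjacency `Adj`, whose edges are coloured by `c`. -/
def IsMonoPath {k : ℕ} (Adj : ℕ+ → ℕ+ → Prop) (c : Sym2 ℕ+ → Fin k) (i : Fin k)
    (P : Set ℕ+) : Prop :=
  (∃ (n : ℕ) (f : Fin n → ℕ+), Function.Injective f ∧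
    (∀ (j : ℕ) (h : j + 1 < n),
      Adj (f ⟨j, Nat.lt_of_succ_lt h⟩) (f ⟨j + 1, h⟩) ∧
      c s(f ⟨j, Nat.lt_of_succ_lt h⟩, f ⟨j + 1, h⟩) = i) ∧
    P = Set.range f) ∨
  (∃ f : ℕ → ℕ+, Function.Injective f ∧
    (∀ j : ℕ, Adj (f j) (f (j + 1)) ∧ c s(f j, f (j + 1)) = i) ∧
    P = Set.range f)

/-- Abstract system of ultrafilter colours and classes. -/
structure Sys (Ω κ : Type*) where
  c : Ω → Ω → Fin 4
  cls : Fin 4 → Ω → Option κ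
  a1 : ∀ V W, ∃ k, cls (c V W) V = some k
  a2 : ∀ i V V' W, c V W = i → c V' W = i → cls i V = cls i V'
  a3 : ∀ i V W k, c V W = i → cls i W = some k → cls i V = some k

open Classical in
/-- indicator of a proposition -/
noncomputable def indP (P : Prop) : ℕ := if P then 1 else 0

theorem indP_true {P : Prop} (h : P) : indP P = 1 := by simp [indP, h]

theorem propA {A B C D E F : Prop} (h : A ∨ B ∨ C ∨ D) (h' : A ∨ B ∨ E ∨ F) :
    A ∨ B ∨ ((C ∨ D) ∧ (E ∨ F)) := by grind

theorem propB {A B X3 Y3 X4 Y4 : Prop} (h : A ∨ B ∨ (X3 ∧ Y4) ∨ (X4 ∧ Y3))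
    (n3 : ¬ (X3 ∧ Y3)) (n4 : ¬ (X4 ∧ Y4)) (T : X3 ∨ Y4) (T' : Y3 ∨ X4) : A ∨ B := by grind

theorem propC {I I' J J' L R : Prop} (d1 : I ∨ J' ∨ L) (d2 : I' ∨ J ∨ L) (d3 : I ∨ J ∨ R)
    (d4 : I' ∨ J' ∨ R) (n1 : ¬ (I ∧ I')) (n2 : ¬ (J ∧ J')) :
    ((I ∨ I') ∧ (J ∨ J')) ∨ (L ∧ R) := by grind

namespace Sys
variable {Ω κ : Type*} (S : Sys Ω κ)

/-- fourfold cover by twelve classes -/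
def Cover : Prop := ∃ L : List (Fin 4 × κ), L.length ≤ 12 ∧
  ∀ V, 4 ≤ (L.map (fun p => indP (S.cls p.1 V = some p.2))).sum

theorem cover3 {i j k : Fin 4} {a b d : κ}
    (h : ∀ V, S.cls i V = some a ∨ S.cls j V = some b ∨ S.cls k V = some d) : S.Cover := by
  refine ⟨[(i,a),(i,a),(i,a),(i,a),(j,b),(j,b),(j,b),(j,b),(k,d),(k,d),(k,d),(k,d)], by simp, ?_⟩
  intro V
  simp only [List.map_cons, List.map_nil, List.sum_cons, List.sum_nil]
  rcases h V with h | h | h <;> have := indP_true h <;> omega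

theorem cover12 {i j k l : Fin 4} {a b x3 y3 x4 y4 I I' J J' : κ}
    (h : ∀ V, 4 ≤ 2 * indP (S.cls i V = some a) + 2 * indP (S.cls j V = some b)
      + indP (S.cls k V = some x3) + indP (S.cls l V = some y4)
      + indP (S.cls l V = some x4) + indP (S.cls k V = some y3)
      + indP (S.cls i V = some I) + indP (S.cls i V = some I')
      + indP (S.cls j V = some J) + indP (S.cls j V = some J')) : S.Cover := by
  refine ⟨[(i,a),(i,a),(j,b),(j,b),(k,x3),(l,y4),(l,x4),(k,y3),(i,I),(i,I'),(j,J),(j,J')],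
    by simp, ?_⟩
  intro V
  simp only [List.map_cons, List.map_nil, List.sum_cons, List.sum_nil]
  have := h V
  omega

/-- hypotheses of case II -/
structure CII (i j k l : Fin 4) (a b x3 y3 x4 y4 : κ) : Prop where
  hall : ∀ t : Fin 4, t = i ∨ t = j ∨ t = k ∨ t = l
  h3 : x3 ≠ y3
  h4 : x4 ≠ y4
  main : ∀ V, S.cls i V = some a ∨ S.cls j V = some b ∨
    (S.cls k V = some x3 ∧ S.cls l V = some y4) ∨ (S.cls l V = some x4 ∧ S.cls k V = some y3)

variable {S}
variable {i j k l : Fin 4} {a b x3 y3 x4 y4 : κ}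

theorem CII.s1 (h : S.CII i j k l a b x3 y3 x4 y4) : S.CII j i k l b a x3 y3 x4 y4 :=
  ⟨fun t => by have := h.hall t; tauto, h.h3, h.h4, fun V => by have := h.main V; tauto⟩
theorem CII.s2 (h : S.CII i j k l a b x3 y3 x4 y4) : S.CII i j k l a b y3 x3 y4 x4 :=
  ⟨h.hall, h.h3.symm, h.h4.symm, fun V => by have := h.main V; tauto⟩
theorem CII.s3 (h : S.CII i j k l a b x3 y3 x4 y4) : S.CII i j l k a b y4 x4 y3 x3 :=
  ⟨fun t => by have := h.hall t; tauto, h.h4.symm, h.h3.symm, fun V => by have := h.main V; tauto⟩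

/-- membership in the part `P` -/
def InP (S : Sys Ω κ) (i j k l : Fin 4) (a b x y : κ) (p : Ω) : Prop :=
  S.cls i p ≠ some a ∧ S.cls j p ≠ some b ∧ S.cls k p = some x ∧ S.cls l p = some y

theorem CII.partA (h : S.CII i j k l a b x3 y3 x4 y4) {p p' : Ω}
    (hp : InP S i j k l a b x3 y4 p) (hp' : InP S i j k l a b y3 x4 p')
    (h1 : S.c p p' = i) (h2 : S.c p' p = j) : S.Cover := by
  obtain ⟨I, hI⟩ := S.a1 p p'
  obtain ⟨J, hJ⟩ := S.a1 p' p
  rw [h1] at hI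
  rw [h2] at hJ
  obtain ⟨q1, q2, q3, q4⟩ := hp
  obtain ⟨r1, r2, r3, r4⟩ := hp'
  refine S.cover12 (i := i) (j := j) (k := k) (l := l) (a := a) (b := b) (x3 := x3) (y3 := y3)
    (x4 := x4) (y4 := y4) (I := I) (I' := I) (J := J) (J' := J) ?_
  intro V
  have e1 : S.c V p = i → S.cls i V = some I := fun e => S.a3 _ _ _ _ e hI
  have e2 : S.c V p' = i → S.cls i V = some I := fun e => (S.a2 _ _ _ _ e h1).trans hI
  have e3 : S.c V p = j → S.cls j V = some J := fun e => (S.a2 _ _ _ _ e h2).trans hJ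
  have e4 : S.c V p' = j → S.cls j V = some J := fun e => S.a3 _ _ _ _ e hJ
  have e5 : S.c V p = k → S.cls k V = some x3 := fun e => S.a3 _ _ _ _ e q3
  have e6 : S.c V p = l → S.cls l V = some y4 := fun e => S.a3 _ _ _ _ e q4
  have e7 : S.c V p' = k → S.cls k V = some y3 := fun e => S.a3 _ _ _ _ e r3
  have e8 : S.c V p' = l → S.cls l V = some x4 := fun e => S.a3 _ _ _ _ e r4
  have m := h.main V
  have c1 := h.hall (S.c V p)
  have c2 := h.hall (S.c V p')
  have n3 : ¬ (S.cls k V = some x3 ∧ S.cls k V = some y3) := by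
    rintro ⟨u, v⟩; exact h.h3 (by simpa [u] using v)
  have n4 : ¬ (S.cls l V = some x4 ∧ S.cls l V = some y4) := by
    rintro ⟨u, v⟩; exact h.h4 (by simpa [u] using v)
  have T1 : S.cls i V = some I ∨ S.cls j V = some J ∨
    ((S.cls k V = some x3 ∨ S.cls l V = some y4) ∧
      (S.cls k V = some y3 ∨ S.cls l V = some x4)) := by
    have c1' := propA (c1.imp e1 (Or.imp e3 (Or.imp e5 e6)))
      (c2.imp e2 (Or.imp e4 (Or.imp e7 e8)))
    exact c1'
  rcases T1 with T | T | ⟨T, T'⟩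
  · have := indP_true T
    rcases m with m | m | ⟨m, m'⟩ | ⟨m, m'⟩
    all_goals have := indP_true m
    · omega
    · omega
    all_goals have := indP_true m'
    all_goals omega
  · have := indP_true T
    rcases m with m | m | ⟨m, m'⟩ | ⟨m, m'⟩
    all_goals have := indP_true m
    · omega
    · omega
    all_goals have := indP_true m'
    all_goals omega
  · have m' : S.cls i V = some a ∨ S.cls j V = some b := propB m n3 n4 T T'
    rcases T with T | T <;> rcases T' with T' | T' <;> rcases m' with m' | m' <;>
    · have := indP_true T
      have := indP_true T'
      have := indP_true m'
      omega

/-- sublemma: an exceptional vertex yields a 3-cover -/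
theorem CII.sub (h : S.CII i j k l a b x3 y3 x4 y4) {J : κ} {p1 p2 v : Ω}
    (hp1 : InP S i j k l a b x3 y4 p1) (hp2 : InP S i j k l a b x3 y4 p2)
    (hJ1 : S.cls j p1 = some J)
    (I2 : κ) (hI2 : S.cls i p2 = some I2)
    (v1 : S.cls i v = some a) (v2 : S.cls j v ≠ some b) (v3 : S.cls j v ≠ some J)
    (v4 : S.cls k v ≠ some x3) (v5 : S.cls l v ≠ some y4) (v6 : S.cls k v = some y3)
    : S.Cover := by
  obtain ⟨q1, q2, q3, q4⟩ := hp1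
  obtain ⟨r1, r2, r3, r4⟩ := hp2
  have hI2a : I2 ≠ a := fun e => r1 (e ▸ hI2)
  have d2 : S.c v p2 = j := by
    rcases h.hall (S.c v p2) with e | e | e | e
    · have := S.a3 _ _ _ _ e hI2; rw [v1] at this; exact absurd (Option.some.inj this).symm hI2a
    · exact e
    · exact absurd (S.a3 _ _ _ _ e r3) v4
    · exact absurd (S.a3 _ _ _ _ e r4) v5
  have d1 : S.c v p1 = i := by
    rcases h.hall (S.c v p1) with e | e | e | e
    · exact e
    · exact absurd (S.a3 _ _ _ _ e hJ1) v3
    · exact absurd (S.a3 _ _ _ _ e q3) v4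
    · exact absurd (S.a3 _ _ _ _ e q4) v5
  obtain ⟨J', hJ'⟩ := S.a1 v p2
  rw [d2] at hJ'
  have hJJ : J' ≠ J := fun e => v3 (e ▸ hJ')
  have hJb : J' ≠ b := fun e => v2 (e ▸ hJ')
  have d3 : S.c p1 v = l := by
    rcases h.hall (S.c p1 v) with e | e | e | e
    · exact absurd (S.a3 _ _ _ _ e v1) q1
    · have := S.a3 _ _ _ _ e hJ'; rw [hJ1] at this; exact absurd (Option.some.inj this).symm hJJ
    · have := S.a3 _ _ _ _ e v6; rw [q3] at this; exact absurd (Option.some.inj this) h.h3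
    · exact e
  refine S.cover3 (i := i) (j := k) (k := l) (a := a) (b := y3) (d := y4) ?_
  intro w
  rcases h.hall (S.c w v) with e | e | e | e
  · exact Or.inl (S.a3 _ _ _ _ e v1)
  · have hw := S.a3 _ _ _ _ e hJ'
    rcases h.hall (S.c w p1) with e' | e' | e' | e'
    · exact Or.inl ((S.a2 _ _ _ _ e' d1).trans v1)
    · have := S.a3 _ _ _ _ e' hJ1; rw [hw] at this; exact absurd (Option.some.inj this) hJJ
    · rcases h.main w with m | m | m | m
      · exact Or.inl m
      · rw [hw] at m; exact absurd (Option.some.inj m) hJb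
      · exact Or.inr (Or.inr m.2)
      · exact Or.inr (Or.inl m.2)
    · exact Or.inr (Or.inr (S.a3 _ _ _ _ e' q4))
  · exact Or.inr (Or.inl (S.a3 _ _ _ _ e v6))
  · exact Or.inr (Or.inr ((S.a2 _ _ _ _ e d3).trans q4))

theorem InP.s1 {x y : κ} {p : Ω} (h : InP S i j k l a b x y p) : InP S j i k l b a x y p :=
  ⟨h.2.1, h.1, h.2.2⟩
theorem InP.s3 {x y : κ} {p : Ω} (h : InP S i j k l a b x y p) : InP S i j l k a b y x p :=
  ⟨h.1, h.2.1, h.2.2.2, h.2.2.1⟩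

theorem CII.pp (h : S.CII i j k l a b x3 y3 x4 y4) {p p' : Ω}
    (hp : InP S i j k l a b x3 y4 p) (hp' : InP S i j k l a b y3 x4 p') :
    S.c p p' = i ∨ S.c p p' = j := by
  obtain ⟨q1, q2, q3, q4⟩ := hp
  obtain ⟨r1, r2, r3, r4⟩ := hp'
  rcases h.hall (S.c p p') with e | e | e | e
  · exact Or.inl e
  · exact Or.inr e
  · have := S.a3 _ _ _ _ e r3; rw [q3] at this; exact absurd (Option.some.inj this) h.h3
  · have := S.a3 _ _ _ _ e r4; rw [q4] at this; exact absurd (Option.some.inj this).symm h.h4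

theorem CII.four (h : S.CII i j k l a b x3 y3 x4 y4) {p p' p1 p1' : Ω} {I I' J J' : κ}
    (hp : InP S i j k l a b x3 y4 p) (hp' : InP S i j k l a b y3 x4 p')
    (hp1 : InP S i j k l a b x3 y4 p1) (hp1' : InP S i j k l a b y3 x4 p1')
    (u1 : S.cls i p = some I) (u2 : S.cls j p = some J')
    (u3 : S.cls i p1 = some I') (u4 : S.cls j p1 = some J)
    (u5 : S.cls i p' = some I) (u6 : S.cls j p' = some J)
    (u7 : S.cls i p1' = some I') (u8 : S.cls j p1' = some J')
    (hI : I ≠ I') (hJ : J ≠ J') : S.Cover := by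
  refine S.cover12 (i := i) (j := j) (k := k) (l := l) (a := a) (b := b) (x3 := x3) (y3 := y3)
    (x4 := x4) (y4 := y4) (I := I) (I' := I') (J := J) (J' := J') ?_
  intro V
  have key : ∀ {q : Ω} {α β γ δ : κ}, S.cls i q = some α → S.cls j q = some β →
      S.cls k q = some γ → S.cls l q = some δ → S.cls i V = some α ∨ S.cls j V = some β ∨
      (S.cls k V = some γ ∨ S.cls l V = some δ) := fun {q} {_ _ _ _} w1 w2 w3 w4 =>
    (h.hall (S.c V q)).imp (fun e => S.a3 _ _ _ _ e w1) (Or.imp (fun e => S.a3 _ _ _ _ e w2)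
      (Or.imp (fun e => S.a3 _ _ _ _ e w3) (fun e => S.a3 _ _ _ _ e w4)))
  have d1 := key u1 u2 hp.2.2.1 hp.2.2.2
  have d2 := key u3 u4 hp1.2.2.1 hp1.2.2.2
  have d3 := key u5 u6 hp'.2.2.1 hp'.2.2.2
  have d4 := key u7 u8 hp1'.2.2.1 hp1'.2.2.2
  have n3 : ¬ (S.cls k V = some x3 ∧ S.cls k V = some y3) := by
    rintro ⟨u, v⟩; exact h.h3 (by simpa [u] using v)
  have n4 : ¬ (S.cls l V = some x4 ∧ S.cls l V = some y4) := by
    rintro ⟨u, v⟩; exact h.h4 (by simpa [u] using v)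
  have n1 : ¬ (S.cls i V = some I ∧ S.cls i V = some I') := by
    rintro ⟨u, v⟩; exact hI (by simpa [u] using v)
  have n2 : ¬ (S.cls j V = some J ∧ S.cls j V = some J') := by
    rintro ⟨u, v⟩; exact hJ (by simpa [u] using v)
  have m := h.main V
  rcases propC d1 d2 d3 d4 n1 n2 with ⟨T, T'⟩ | ⟨T, T'⟩
  · have w1 : 1 ≤ indP (S.cls i V = some I) + indP (S.cls i V = some I') := by
      rcases T with T | T <;> have := indP_true T <;> omega
    have w2 : 1 ≤ indP (S.cls j V = some J) + indP (S.cls j V = some J') := by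
      rcases T' with T | T <;> have := indP_true T <;> omega
    rcases m with m | m | ⟨m, m'⟩ | ⟨m, m'⟩
    all_goals have := indP_true m
    · omega
    · omega
    all_goals have := indP_true m'
    all_goals omega
  · have m' : S.cls i V = some a ∨ S.cls j V = some b := propB m n3 n4 T T'
    rcases T with T | T <;> rcases T' with T' | T' <;> rcases m' with m' | m' <;>
    · have := indP_true T
      have := indP_true T'
      have := indP_true m'
      omega

theorem CII.partB1 (h : S.CII i j k l a b x3 y3 x4 y4) {p0 p0' p1 : Ω} {I : κ}
    (hp0 : InP S i j k l a b x3 y4 p0) (hp0' : InP S i j k l a b y3 x4 p0')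
    (hp1 : InP S i j k l a b x3 y4 p1)
    (comm : ∀ p p', InP S i j k l a b x3 y4 p → InP S i j k l a b y3 x4 p' →
      S.c p p' = S.c p' p)
    (hI : S.cls i p0 = some I) (hI' : S.cls i p0' = some I)
    (hn : S.cls i p1 ≠ some I) : S.Cover := by
  have e1 : S.c p1 p0' = j := (h.pp hp1 hp0').resolve_left
    (fun e => hn (S.a3 _ _ _ _ e hI'))
  have e1' : S.c p0' p1 = j := (comm _ _ hp1 hp0') ▸ e1
  obtain ⟨J, hJ'⟩ := S.a1 p0' p1
  rw [e1'] at hJ'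
  have hJ := S.a3 _ _ _ _ e1 hJ'
  have split : ∀ V, S.cls i V = some a ∨ S.cls j V = some b ∨ InP S i j k l a b x3 y4 V ∨
      InP S i j k l a b y3 x4 V := by
    intro V
    by_cases hA : S.cls i V = some a
    · exact Or.inl hA
    by_cases hB : S.cls j V = some b
    · exact Or.inr (Or.inl hB)
    rcases h.main V with m | m | m | m
    · exact absurd m hA
    · exact absurd m hB
    · exact Or.inr (Or.inr (Or.inl ⟨hA, hB, m⟩))
    · exact Or.inr (Or.inr (Or.inr ⟨hA, hB, m.2, m.1⟩))
  by_cases hex : ∃ p1', InP S i j k l a b y3 x4 p1' ∧ S.cls j p1' ≠ some J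
  · obtain ⟨p1', hp1', hn'⟩ := hex
    have e2' : S.c p1' p1 = i := by
      rcases h.pp hp1 hp1' with e | e
      · rw [← comm _ _ hp1 hp1']; exact e
      · rw [comm _ _ hp1 hp1'] at e; exact absurd (S.a3 _ _ _ _ e hJ) hn'
    have e2 : S.c p1 p1' = i := (comm _ _ hp1 hp1').trans e2'
    obtain ⟨I', hI1⟩ := S.a1 p1 p1'
    rw [e2] at hI1
    have hI1' := S.a3 _ _ _ _ e2' hI1
    have hII : I ≠ I' := fun e => hn (e ▸ hI1)
    have e3 : S.c p0 p1' = j := by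
      rcases h.pp hp0 hp1' with e | e
      · have := S.a3 _ _ _ _ e hI1'; rw [hI] at this; exact absurd (Option.some.inj this) hII
      · exact e
    have e3' : S.c p1' p0 = j := (comm _ _ hp0 hp1') ▸ e3
    obtain ⟨J', hJ1⟩ := S.a1 p0 p1'
    rw [e3] at hJ1
    have hJ1' := S.a3 _ _ _ _ e3' hJ1
    exact h.four hp0 hp0' hp1 hp1' hI hJ1 hI1 hJ hI' hJ' hI1' hJ1' hII (fun e => hn' (e ▸ hJ1'))
  · push Not at hex
    by_cases hall : ∀ p, InP S i j k l a b x3 y4 p → S.cls j p = some J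
    · refine S.cover3 (i := i) (j := j) (k := j) (a := a) (b := b) (d := J) fun V => ?_
      exact (split V).imp id (Or.imp id (fun t => t.elim (hall V) (hex V)))
    · push Not at hall
      obtain ⟨p2, hp2, hn2⟩ := hall
      have f2 : ∀ p', InP S i j k l a b y3 x4 p' → S.c p2 p' = i := fun p' hp' =>
        (h.pp hp2 hp').resolve_right (fun e => hn2 (S.a3 _ _ _ _ e (hex p' hp')))
      have hI2 : S.cls i p2 = some I := S.a3 _ _ _ _ (f2 _ hp0') hI'
      have f3 : ∀ p', InP S i j k l a b y3 x4 p' → S.cls i p' = some I := fun p' hp' =>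
        S.a3 _ _ _ _ ((comm _ _ hp2 hp').symm.trans (f2 _ hp')) hI2
      have f4 : ∀ p, InP S i j k l a b x3 y4 p → S.cls i p = some I ∨ S.cls j p = some J :=
        fun p hp => (h.pp hp hp0').imp (fun e => S.a3 _ _ _ _ e hI') (fun e => S.a3 _ _ _ _ e hJ')
      have hIa : I ≠ a := fun e => hp0.1 (e ▸ hI)
      have hJb : J ≠ b := fun e => hp1.2.1 (e ▸ hJ)
      by_contra hc
      refine hc (S.cover12 (i := i) (j := j) (k := k) (l := l) (a := a) (b := b) (x3 := x3)
        (y3 := y3) (x4 := x4) (y4 := y4) (I := I) (I' := I) (J := J) (J' := J) ?_)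
      intro V
      have key : S.cls i V = some I ∨ S.cls j V = some J ∨ S.cls k V = some y3 ∨
          S.cls l V = some x4 :=
        (h.hall (S.c V p0')).imp (fun e => S.a3 _ _ _ _ e hI')
          (Or.imp (fun e => S.a3 _ _ _ _ e hJ')
          (Or.imp (fun e => S.a3 _ _ _ _ e hp0'.2.2.1) (fun e => S.a3 _ _ _ _ e hp0'.2.2.2)))
      rcases split V with m | m | m | m
      · have := indP_true m
        by_cases hB : S.cls j V = some b
        · have := indP_true hB
          omega
        by_cases hJV : S.cls j V = some J
        · have := indP_true hJV
          omega
        have hIV : S.cls i V ≠ some I := fun e => hIa (by simpa [e] using m)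
        have hXY : S.cls k V = some x3 ∨ S.cls l V = some y4 := by
          by_contra hx
          push Not at hx
          rcases key with e | e | e | e
          · exact hIV e
          · exact hJV e
          · exact hc (h.sub hp1 hp2 hJ I hI2 m hB hJV hx.1 hx.2 e)
          · exact hc (h.s3.sub hp1.s3 hp2.s3 hJ I hI2 m hB hJV hx.2 hx.1 e)
        rcases key with e | e | e | e
        · exact absurd e hIV
        · exact absurd e hJV
        all_goals rcases hXY with e' | e'
        all_goals have := indP_true e
        all_goals have := indP_true e'
        all_goals omega
      · have := indP_true m
        by_cases hA : S.cls i V = some a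
        · have := indP_true hA
          omega
        by_cases hIV : S.cls i V = some I
        · have := indP_true hIV
          omega
        have hJV : S.cls j V ≠ some J := fun e => hJb (by simpa [e] using m)
        have hXY : S.cls k V = some x3 ∨ S.cls l V = some y4 := by
          by_contra hx
          push Not at hx
          rcases key with e | e | e | e
          · exact hIV e
          · exact hJV e
          · exact hc (h.s1.sub hp2.s1 hp1.s1 hI2 J hJ m hA hIV hx.1 hx.2 e)
          · exact hc (h.s1.s3.sub hp2.s1.s3 hp1.s1.s3 hI2 J hJ m hA hIV hx.2 hx.1 e)
        rcases key with e | e | e | e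
        · exact absurd e hIV
        · exact absurd e hJV
        all_goals rcases hXY with e' | e'
        all_goals have := indP_true e
        all_goals have := indP_true e'
        all_goals omega
      · have := indP_true m.2.2.1
        have := indP_true m.2.2.2
        rcases f4 V m with e | e <;> have := indP_true e <;> omega
      · have := indP_true (f3 V m)
        have := indP_true (hex V m)
        omega

theorem CII.partB (h : S.CII i j k l a b x3 y3 x4 y4) {p0 p0' : Ω}
    (hp0 : InP S i j k l a b x3 y4 p0) (hp0' : InP S i j k l a b y3 x4 p0')
    (comm : ∀ p p', InP S i j k l a b x3 y4 p → InP S i j k l a b y3 x4 p' →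
      S.c p p' = S.c p' p)
    (h0 : S.c p0 p0' = i) : S.Cover := by
  have h0' : S.c p0' p0 = i := (comm _ _ hp0 hp0') ▸ h0
  obtain ⟨I, hI⟩ := S.a1 p0 p0'
  rw [h0] at hI
  have hI' := S.a3 _ _ _ _ h0' hI
  by_cases hP : ∃ p1, InP S i j k l a b x3 y4 p1 ∧ S.cls i p1 ≠ some I
  · obtain ⟨p1, hp1, hn⟩ := hP
    exact h.partB1 hp0 hp0' hp1 comm hI hI' hn
  by_cases hP' : ∃ p1, InP S i j k l a b y3 x4 p1 ∧ S.cls i p1 ≠ some I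
  · obtain ⟨p1, hp1, hn⟩ := hP'
    exact h.s2.partB1 hp0' hp0 hp1 (fun p p' q q' => (comm p' p q' q).symm) hI' hI hn
  push Not at hP hP'
  refine S.cover3 (i := i) (j := j) (k := i) (a := a) (b := b) (d := I) fun V => ?_
  by_cases hA : S.cls i V = some a
  · exact Or.inl hA
  by_cases hB : S.cls j V = some b
  · exact Or.inr (Or.inl hB)
  rcases h.main V with m | m | m | m
  · exact absurd m hA
  · exact absurd m hB
  · exact Or.inr (Or.inr (hP V ⟨hA, hB, m⟩))
  · exact Or.inr (Or.inr (hP' V ⟨hA, hB, m.2, m.1⟩))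

theorem CII.cover (h : S.CII i j k l a b x3 y3 x4 y4) : S.Cover := by
  have split : ∀ V, S.cls i V = some a ∨ S.cls j V = some b ∨ InP S i j k l a b x3 y4 V ∨
      InP S i j k l a b y3 x4 V := by
    intro V
    by_cases hA : S.cls i V = some a
    · exact Or.inl hA
    by_cases hB : S.cls j V = some b
    · exact Or.inr (Or.inl hB)
    rcases h.main V with m | m | m | m
    · exact absurd m hA
    · exact absurd m hB
    · exact Or.inr (Or.inr (Or.inl ⟨hA, hB, m⟩))
    · exact Or.inr (Or.inr (Or.inr ⟨hA, hB, m.2, m.1⟩))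
  by_cases hP : ∃ p, InP S i j k l a b x3 y4 p
  swap
  · push Not at hP
    refine S.cover3 (i := i) (j := j) (k := l) (a := a) (b := b) (d := x4) fun V => ?_
    exact (split V).imp id (Or.imp id (fun t => t.elim (fun t => absurd t (hP V)) (·.2.2.2)))
  by_cases hP' : ∃ p, InP S i j k l a b y3 x4 p
  swap
  · push Not at hP'
    refine S.cover3 (i := i) (j := j) (k := k) (a := a) (b := b) (d := x3) fun V => ?_
    exact (split V).imp id (Or.imp id (fun t => t.elim (·.2.2.1) (fun t => absurd t (hP' V))))
  by_cases comm : ∀ p p', InP S i j k l a b x3 y4 p → InP S i j k l a b y3 x4 p' →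
      S.c p p' = S.c p' p
  · obtain ⟨p, hp⟩ := hP
    obtain ⟨p', hp'⟩ := hP'
    rcases h.pp hp hp' with e | e
    · exact h.partB hp hp' comm e
    · exact h.s1.partB hp.s1 hp'.s1 (fun q q' w w' => comm q q' w.s1 w'.s1) e
  · push Not at comm
    obtain ⟨p, p', hp, hp', hne⟩ := comm
    rcases h.pp hp hp' with e | e <;> rcases h.s2.pp hp' hp with e' | e'
    · exact absurd (e.trans e'.symm) hne
    · exact h.partA hp hp' e e'
    · exact h.s1.partA hp.s1 hp'.s1 e e'
    · exact absurd (e.trans e'.symm) hne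

/-- conclusion of lemma D -/
def Dc (S : Sys Ω κ) (U W : Ω) (t : Fin 4) (q : κ) : Prop :=
  (∃ s, S.c s U = t) ∧ (∃ s, S.c s W = t) ∧
    ∀ s, (S.c s U = t ∨ S.c s W = t) → S.cls t s = some q

theorem lemD1 {i j k l : Fin 4} (hall : ∀ t : Fin 4, t = i ∨ t = j ∨ t = k ∨ t = l)
    {U W : Ω} (h1 : S.c U W = i) (h2 : S.c W U = j) {a b : κ} (ha : S.cls i U = some a)
    (hb : S.cls j W = some b) (hnc : ¬ S.Cover) (Z : Ω)
    (hZ : Z = U ∨ Z = W) : ∃ x, (∃ s, S.cls i s ≠ some a ∧ S.cls j s ≠ some b ∧ S.c s Z = k) ∧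
      ∀ s, S.c s Z = k → S.cls k s = some x := by
  have hR : ∀ V, S.cls i V = some a ∨ S.cls j V = some b ∨ S.c V Z = k ∨ S.c V Z = l := by
    intro V
    rcases hZ with rfl | rfl
    · exact (hall (S.c V Z)).imp (fun e => S.a3 _ _ _ _ e ha)
        (Or.imp (fun e => (S.a2 _ _ _ _ e h2).trans hb) id)
    · exact (hall (S.c V Z)).imp (fun e => (S.a2 _ _ _ _ e h1).trans ha)
        (Or.imp (fun e => S.a3 _ _ _ _ e hb) id)
  by_cases hex : ∃ s, S.cls i s ≠ some a ∧ S.cls j s ≠ some b ∧ S.c s Z = k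
  · obtain ⟨s, hs⟩ := hex
    obtain ⟨x, hx⟩ := S.a1 s Z
    rw [hs.2.2] at hx
    exact ⟨x, ⟨s, hs⟩, fun s' e => (S.a2 _ _ _ _ e hs.2.2).trans hx⟩
  · exfalso
    push Not at hex
    by_cases hne : ∃ s, S.c s Z = l
    · obtain ⟨s, hs⟩ := hne
      obtain ⟨x, hx⟩ := S.a1 s Z
      rw [hs] at hx
      refine hnc (S.cover3 (i := i) (j := j) (k := l) (a := a) (b := b) (d := x) fun V => ?_)
      by_cases hA : S.cls i V = some a
      · exact Or.inl hA
      by_cases hB : S.cls j V = some b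
      · exact Or.inr (Or.inl hB)
      rcases hR V with m | m | m | m
      · exact Or.inl m
      · exact Or.inr (Or.inl m)
      · exact absurd m (hex V hA hB)
      · exact Or.inr (Or.inr ((S.a2 _ _ _ _ m hs).trans hx))
    · push Not at hne
      refine hnc (S.cover3 (i := i) (j := j) (k := j) (a := a) (b := b) (d := b) fun V => ?_)
      by_cases hA : S.cls i V = some a
      · exact Or.inl hA
      by_cases hB : S.cls j V = some b
      · exact Or.inr (Or.inl hB)
      rcases hR V with m | m | m | m
      · exact Or.inl m
      · exact Or.inr (Or.inl m)
      · exact absurd m (hex V hA hB)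
      · exact absurd m (hne V)

theorem lemD2 {i j k l : Fin 4} (hall : ∀ t : Fin 4, t = i ∨ t = j ∨ t = k ∨ t = l)
    {U W : Ω} (h1 : S.c U W = i) (h2 : S.c W U = j) (hnc : ¬ S.Cover) :
    ∃ q, S.Dc U W k q := by
  obtain ⟨a, ha⟩ := S.a1 U W
  obtain ⟨b, hb⟩ := S.a1 W U
  rw [h1] at ha
  rw [h2] at hb
  have hall' : ∀ t : Fin 4, t = i ∨ t = j ∨ t = l ∨ t = k := fun t => by
    have := hall t; tauto
  obtain ⟨x3, ⟨s3, -, -, es3⟩, hx3⟩ := lemD1 hall h1 h2 ha hb hnc U (Or.inl rfl)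
  obtain ⟨y3, ⟨t3, -, -, et3⟩, hy3⟩ := lemD1 hall h1 h2 ha hb hnc W (Or.inr rfl)
  obtain ⟨x4, ⟨s4, -, -, es4⟩, hx4⟩ := lemD1 hall' h1 h2 ha hb hnc U (Or.inl rfl)
  obtain ⟨y4, ⟨t4, -, -, et4⟩, hy4⟩ := lemD1 hall' h1 h2 ha hb hnc W (Or.inr rfl)
  have hU : ∀ V, S.cls i V = some a ∨ S.cls j V = some b ∨ S.cls k V = some x3 ∨
      S.cls l V = some x4 := fun V =>
    (hall (S.c V U)).imp (fun e => S.a3 _ _ _ _ e ha)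
        (Or.imp (fun e => (S.a2 _ _ _ _ e h2).trans hb) (Or.imp (hx3 V) (hx4 V)))
  have hW : ∀ V, S.cls i V = some a ∨ S.cls j V = some b ∨ S.cls k V = some y3 ∨
      S.cls l V = some y4 := fun V =>
    (hall (S.c V W)).imp (fun e => (S.a2 _ _ _ _ e h1).trans ha)
        (Or.imp (fun e => S.a3 _ _ _ _ e hb) (Or.imp (hy3 V) (hy4 V)))
  by_cases e3 : x3 = y3
  · subst e3
    exact ⟨x3, ⟨s3, es3⟩, ⟨t3, et3⟩, fun s e => e.elim (hx3 s) (hy3 s)⟩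
  · exfalso
    by_cases e4 : x4 = y4
    · subst e4
      refine hnc (S.cover3 (i := i) (j := j) (k := l) (a := a) (b := b) (d := x4) fun V => ?_)
      rcases hU V with m | m | m | m
      · exact Or.inl m
      · exact Or.inr (Or.inl m)
      · rcases hW V with m' | m' | m' | m'
        · exact Or.inl m'
        · exact Or.inr (Or.inl m')
        · exact absurd (by simpa [m] using m') e3
        · exact Or.inr (Or.inr m')
      · exact Or.inr (Or.inr m)
    · refine hnc (CII.cover (i := i) (j := j) (k := k) (l := l) (a := a) (b := b) (x3 := x3)
        (y3 := y3) (x4 := x4) (y4 := y4) ⟨hall, e3, e4, fun V => ?_⟩)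
      rcases hU V with m | m | m | m
      · exact Or.inl m
      · exact Or.inr (Or.inl m)
      · rcases hW V with m' | m' | m' | m'
        · exact Or.inl m'
        · exact Or.inr (Or.inl m')
        · exact absurd (by simpa [m] using m') e3
        · exact Or.inr (Or.inr (Or.inl ⟨m, m'⟩))
      · rcases hW V with m' | m' | m' | m'
        · exact Or.inl m'
        · exact Or.inr (Or.inl m')
        · exact Or.inr (Or.inr (Or.inr ⟨m, m'⟩))
        · exact absurd (by simpa [m] using m') e4

theorem fin4_compl : ∀ i j t : Fin 4, i ≠ j → t ≠ i → t ≠ j →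
    ∃ l, l ≠ i ∧ l ≠ j ∧ ∀ s : Fin 4, s = i ∨ s = j ∨ s = t ∨ s = l := by decide

theorem lemD {U W : Ω} (hne : S.c U W ≠ S.c W U) (hnc : ¬ S.Cover) (t : Fin 4)
    (h1 : t ≠ S.c U W) (h2 : t ≠ S.c W U) : ∃ q, S.Dc U W t q := by
  obtain ⟨l, -, -, hl⟩ := fin4_compl _ _ _ hne h1 h2
  exact lemD2 hl rfl rfl hnc

theorem lemP3 (hact : ∀ V, ∃ s t, s ≠ t ∧ S.cls s V ≠ none ∧ S.cls t V ≠ none) {U W : Ω}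
    (hg : ∀ t q, ¬ (S.cls t U = some q ∧ S.cls t W = some q)) : S.Cover := by
  by_contra hnc
  have hiW : ∀ t, S.c U W = t → S.cls t W = none := by
    intro t ht
    by_contra hx
    obtain ⟨q, hq⟩ := Option.ne_none_iff_exists'.mp hx
    exact hg t q ⟨S.a3 _ _ _ _ ht hq, hq⟩
  have hjU : ∀ t, S.c W U = t → S.cls t U = none := by
    intro t ht
    by_contra hx
    obtain ⟨q, hq⟩ := Option.ne_none_iff_exists'.mp hx
    exact hg t q ⟨hq, S.a3 _ _ _ _ ht hq⟩
  have hne : S.c U W ≠ S.c W U := by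
    intro e
    obtain ⟨q, hq⟩ := S.a1 U W
    rw [hjU _ e.symm] at hq
    exact absurd hq (by simp)
  obtain ⟨b, hb⟩ := S.a1 W U
  have hD := lemD hne hnc
  have : Nonempty κ := ⟨b⟩
  choose! Q hQ using hD
  obtain ⟨k, hki, hkj⟩ : ∃ k, k ≠ S.c U W ∧ k ≠ S.c W U := by
    generalize S.c U W = i
    generalize S.c W U = j
    revert i j
    decide
  obtain ⟨l, hli, hlj, hall⟩ := fin4_compl _ _ _ hne hki hkj
  by_cases hV : ∃ V, S.cls (S.c W U) V ≠ some b ∧ S.cls k V ≠ some (Q k) ∧ S.cls l V ≠ some (Q l)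
  swap
  · refine hnc (S.cover3 (i := S.c W U) (j := k) (k := l) (a := b) (b := Q k) (d := Q l)
      fun V => ?_)
    by_contra hx
    exact hV ⟨V, by tauto⟩
  obtain ⟨V, v1, v2, v3⟩ := hV
  have vQ : ∀ t, t ≠ S.c U W → t ≠ S.c W U → S.cls t V ≠ some (Q t) := by
    intro t ht ht'
    rcases hall t with e | e | e | e
    · exact absurd e ht
    · exact absurd e ht'
    · rw [e]; exact v2
    · rw [e]; exact v3
  have cVW : S.c V W = S.c U W := by
    by_contra hx
    by_cases hy : S.c V W = S.c W U
    · exact v1 (S.a3 _ _ _ _ hy hb)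
    · exact vQ _ hx hy ((hQ _ hx hy).2.2 V (Or.inr rfl))
  have b'i : S.c W V ≠ S.c U W := by
    intro e
    obtain ⟨q, hq⟩ := S.a1 W V
    rw [hiW _ e.symm] at hq
    exact absurd hq (by simp)
  have b'V : S.cls (S.c W V) V = none := by
    by_contra hx
    obtain ⟨m, hm⟩ := Option.ne_none_iff_exists'.mp hx
    have hmW := S.a3 _ _ _ _ rfl hm
    by_cases hy : S.c W V = S.c W U
    · rw [hy, hb] at hmW
      rw [hy, ← hmW] at hm
      exact v1 hm
    · obtain ⟨-, ⟨s, hs⟩, hq⟩ := hQ _ b'i hy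
      have z1 := hq s (Or.inr hs)
      have z2 := S.a3 _ _ _ _ hs hmW
      rw [z1] at z2
      rw [← z2] at hm
      exact vQ _ b'i hy hm
  have hne' : S.c V W ≠ S.c W V := by rw [cVW]; exact b'i.symm
  obtain ⟨t, ht, htV⟩ : ∃ t, t ≠ S.c U W ∧ S.cls t V ≠ none := by
    obtain ⟨s, t, hst, hs, ht⟩ := hact V
    by_cases hx : s = S.c U W
    · exact ⟨t, fun e => hst (hx.trans e.symm), ht⟩
    · exact ⟨s, hx, hs⟩
  obtain ⟨m, hm⟩ := Option.ne_none_iff_exists'.mp htV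
  obtain ⟨q, ⟨s, hs⟩, ⟨s', hs'⟩, hq⟩ := lemD hne' hnc t (by rw [cVW]; exact ht)
    (fun e => htV (e ▸ b'V))
  have z1 := hq s (Or.inl hs)
  have z2 := S.a3 _ _ _ _ hs hm
  rw [z1] at z2
  have z3 := hq s' (Or.inr hs')
  by_cases hy : t = S.c W U
  · subst hy
    have z4 := S.a3 _ _ _ _ hs' hb
    rw [z3, z2] at z4
    exact v1 (hm.trans z4)
  · have z4 := (hQ _ ht hy).2.2 s' (Or.inr hs')
    rw [z3, z2] at z4
    exact vQ _ ht hy (hm.trans z4)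

/-- a good pair -/
def Good (S : Sys Ω κ) (V W : Ω) : Prop := ∃ t q, S.cls t V = some q ∧ S.cls t W = some q

theorem trichotomy [Nonempty κ] (S : Sys Ω κ)
    (a4 : ∀ U i, (∀ j, j ≠ i → S.cls j U = none) → ∀ V q, S.cls i V = some q →
      S.cls i U = some q) (hnc : ¬ S.Cover)
    (hT : ¬ ∀ t, ∃ U, ∀ j, j ≠ t → S.cls j U = none) :
    ∃ (T : Finset (Fin 4)) (K : Fin 4 → κ), T.card ≤ 2 ∧
      (∀ t ∈ T, ∀ V, S.cls t V = none ∨ S.cls t V = some (K t)) ∧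
      (∀ V W, (∀ t ∈ T, S.cls t V = none) → (∀ t ∈ T, S.cls t W = none) → S.Good V W) := by
  classical
  by_contra hcon
  set T : Finset (Fin 4) := Finset.univ.filter (fun t => ∃ U, ∀ j, j ≠ t → S.cls j U = none)
    with hTdef
  have hmem : ∀ t, t ∈ T ↔ ∃ U, ∀ j, j ≠ t → S.cls j U = none := by simp [hTdef]
  have hU : ∀ t ∈ T, ∃ q, ∀ V, S.cls t V = none ∨ S.cls t V = some q := by
    intro t ht
    obtain ⟨U, hU⟩ := (hmem t).1 ht
    obtain ⟨q, hq⟩ := S.a1 U U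
    have e : S.c U U = t := by
      by_contra hx
      rw [hU _ hx] at hq
      exact absurd hq (by simp)
    rw [e] at hq
    refine ⟨q, fun V => ?_⟩
    by_cases hx : S.cls t V = none
    · exact Or.inl hx
    obtain ⟨q', hq'⟩ := Option.ne_none_iff_exists'.mp hx
    have := a4 U t hU V q' hq'
    rw [hq] at this
    exact Or.inr (hq'.trans this.symm)
  have hact : ∀ V, (∀ t ∈ T, S.cls t V = none) → ∃ s t, s ≠ t ∧ s ∉ T ∧ t ∉ T ∧
      S.cls s V ≠ none ∧ S.cls t V ≠ none := by
    intro V hV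
    obtain ⟨q, hq⟩ := S.a1 V V
    have hq' : S.cls (S.c V V) V ≠ none := by rw [hq]; simp
    have hsT : S.c V V ∉ T := fun e => hq' (hV _ e)
    by_cases hx : ∃ t, t ≠ S.c V V ∧ S.cls t V ≠ none
    · obtain ⟨t, ht, htV⟩ := hx
      exact ⟨S.c V V, t, ht.symm, hsT, fun e => htV (hV _ e), hq', htV⟩
    · push Not at hx
      exact absurd ((hmem _).2 ⟨V, hx⟩) hsT
  have hcard : T.card = 0 ∨ T.card = 1 ∨ T.card = 2 ∨ T.card = 3 ∨ T.card = 4 := by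
    have : T.card ≤ 4 := by simpa using Finset.card_le_univ T
    omega
  have fin : T.card ≤ 2 → ∃ V W, (∀ t ∈ T, S.cls t V = none) ∧ (∀ t ∈ T, S.cls t W = none) ∧
      ¬ S.Good V W := by
    intro hle
    by_contra hx
    push Not at hx
    choose! q hq using hU
    refine hcon ⟨T, q, hle, fun t ht V => hq t ht V, hx⟩
  rcases hcard with h | h | h | h | h
  · have hT0 : T = ∅ := Finset.card_eq_zero.mp h
    obtain ⟨V, W, -, -, hg⟩ := fin (by omega)
    refine hnc (lemP3 (U := V) (W := W) ?_ ?_)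
    · intro V
      obtain ⟨s, t, h1, -, -, h2, h3⟩ := hact V (by simp [hT0])
      exact ⟨s, t, h1, h2, h3⟩
    · intro t q hh
      exact hg ⟨t, q, hh⟩
  · obtain ⟨τ, hτ⟩ := Finset.card_eq_one.mp h
    obtain ⟨U, W, hU0, hW0, hg⟩ := fin (by omega)
    obtain ⟨q, hq⟩ := hU τ (by simp [hτ])
    have hiW : S.cls (S.c U W) W = none := by
      by_contra hx
      obtain ⟨q, hq⟩ := Option.ne_none_iff_exists'.mp hx
      exact hg ⟨_, q, S.a3 _ _ _ _ rfl hq, hq⟩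
    have hjU : S.cls (S.c W U) U = none := by
      by_contra hx
      obtain ⟨q, hq⟩ := Option.ne_none_iff_exists'.mp hx
      exact hg ⟨_, q, hq, S.a3 _ _ _ _ rfl hq⟩
    obtain ⟨a, ha⟩ := S.a1 U W
    obtain ⟨b, hb⟩ := S.a1 W U
    have hne : S.c U W ≠ S.c W U := by
      intro e; rw [e, hjU] at ha; exact absurd ha (by simp)
    have hτi : τ ≠ S.c U W := by
      rintro rfl
      rw [hU0 _ (by simp [hτ])] at ha; exact absurd ha (by simp)
    have hτj : τ ≠ S.c W U := by
      rintro rfl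
      rw [hW0 _ (by simp [hτ])] at hb; exact absurd hb (by simp)
    obtain ⟨k, hki, hkj, hall⟩ := fin4_compl _ _ _ hne hτi hτj
    have hUk : ∃ u, S.cls k U = some u := by
      obtain ⟨s, t, hst, hs, ht, hs', ht'⟩ := hact U hU0
      have n1 : ∀ s, s ∉ T → S.cls s U ≠ none → s = S.c U W ∨ s = k := by
        intro s hs hs'
        rcases hall s with e | e | e | e
        · exact Or.inl e
        · rw [e] at hs'; exact absurd hjU hs'
        · rw [e, hτ] at hs; simp at hs
        · exact Or.inr e
      apply Option.ne_none_iff_exists'.mp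
      rcases n1 s hs hs' with e | e
      · rcases n1 t ht ht' with e' | e'
        · exact absurd (e.trans e'.symm) hst
        · rw [← e']; exact ht'
      · rw [← e]; exact hs'
    have hWk : ∃ u, S.cls k W = some u := by
      obtain ⟨s, t, hst, hs, ht, hs', ht'⟩ := hact W hW0
      have n1 : ∀ s, s ∉ T → S.cls s W ≠ none → s = S.c W U ∨ s = k := by
        intro s hs hs'
        rcases hall s with e | e | e | e
        · rw [e] at hs'; exact absurd hiW hs'
        · exact Or.inl e
        · rw [e, hτ] at hs; simp at hs
        · exact Or.inr e
      apply Option.ne_none_iff_exists'.mp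
      rcases n1 s hs hs' with e | e
      · rcases n1 t ht ht' with e' | e'
        · exact absurd (e.trans e'.symm) hst
        · rw [← e']; exact ht'
      · rw [← e]; exact hs'
    obtain ⟨u, hu⟩ := hUk
    obtain ⟨w, hw⟩ := hWk
    refine hnc (S.cover3 (i := τ) (j := S.c U W) (k := S.c W U) (a := q) (b := a) (d := b)
      fun V => ?_)
    rcases hq V with hV | hV
    swap
    · exact Or.inl hV
    refine Or.inr ?_
    have nτ : ∀ Y, S.c V Y ≠ τ := by
      intro Y e
      obtain ⟨x, hx⟩ := S.a1 V Y
      rw [e, hV] at hx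
      exact absurd hx (by simp)
    rcases hall (S.c V U) with e | e | e | e
    · exact Or.inl (S.a3 _ _ _ _ e ha)
    · exact Or.inr ((S.a2 _ _ _ _ e rfl).trans hb)
    · exact absurd e (nτ _)
    · rcases hall (S.c V W) with e' | e' | e' | e'
      · exact Or.inl ((S.a2 _ _ _ _ e' rfl).trans ha)
      · exact Or.inr (S.a3 _ _ _ _ e' hb)
      · exact absurd e' (nτ _)
      · have z1 := S.a3 _ _ _ _ e hu
        have z2 := S.a3 _ _ _ _ e' hw
        rw [z1] at z2
        exact absurd ⟨k, u, hu, hw.trans z2.symm⟩ hg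
  · obtain ⟨U, W, hU0, hW0, hg⟩ := fin (by omega)
    have hact2 : ∀ V, (∀ t ∈ T, S.cls t V = none) → ∀ s, s ∉ T → S.cls s V ≠ none := by
      intro V hV s hs
      obtain ⟨x, y, hxy, hx, hy, hx', hy'⟩ := hact V hV
      have : s = x ∨ s = y := by
        have hc : (Tᶜ).card = 2 := by rw [Finset.card_compl, h]; rfl
        by_contra hcc
        push Not at hcc
        have : ({s, x, y} : Finset (Fin 4)) ⊆ Tᶜ := by
          intro z hz
          simp only [Finset.mem_insert, Finset.mem_singleton] at hz
          rcases hz with rfl | rfl | rfl <;> simpa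
        have h3 := Finset.card_le_card this
        rw [Finset.card_eq_three.mpr ⟨s, x, y, hcc.1, hcc.2, hxy, rfl⟩] at h3
        omega
      rcases this with rfl | rfl <;> assumption
    obtain ⟨q, hq⟩ := S.a1 U W
    have hs : S.c U W ∉ T := by
      intro e
      rw [hU0 _ e] at hq
      exact absurd hq (by simp)
    obtain ⟨w, hw⟩ := Option.ne_none_iff_exists'.mp (hact2 W hW0 _ hs)
    exact hg ⟨_, w, S.a3 _ _ _ _ rfl hw, hw⟩
  · obtain ⟨x, y, z, -, -, -, hxyz⟩ := Finset.card_eq_three.mp h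
    obtain ⟨qx, hx⟩ := hU x (by simp [hxyz])
    obtain ⟨qy, hy⟩ := hU y (by simp [hxyz])
    obtain ⟨qz, hz⟩ := hU z (by simp [hxyz])
    refine hnc (S.cover3 (i := x) (j := y) (k := z) (a := qx) (b := qy) (d := qz) fun V => ?_)
    by_contra hv
    push Not at hv
    have hV : ∀ t ∈ T, S.cls t V = none := by
      intro t ht
      rw [hxyz] at ht
      simp only [Finset.mem_insert, Finset.mem_singleton] at ht
      rcases ht with rfl | rfl | rfl
      · exact (hx V).resolve_right hv.1
      · exact (hy V).resolve_right hv.2.1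
      · exact (hz V).resolve_right hv.2.2
    obtain ⟨s, t, hst, hs, ht, -, -⟩ := hact V hV
    have hc : (Tᶜ).card = 1 := by rw [Finset.card_compl, h]; rfl
    obtain ⟨r, hr⟩ := Finset.card_eq_one.mp hc
    have h1 : s ∈ Tᶜ := by simpa
    have h2 : t ∈ Tᶜ := by simpa
    rw [hr] at h1 h2
    simp only [Finset.mem_singleton] at h1 h2
    exact hst (h1.trans h2.symm)
  · refine hT fun t => (hmem t).1 ?_
    have : T = Finset.univ := by
      rw [← Finset.card_eq_iff_eq_univ]; simpa using h
    rw [this]; simp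
end Sys

/-! ### Linked sets -/

/-- step of a colour-`i` path avoiding `X` -/
def lrel (c : Sym2 ℕ+ → Fin 4) (i : Fin 4) (X : Set ℕ+) (u v : ℕ+) : Prop :=
  u ≠ v ∧ c s(u, v) = i ∧ v ∉ X

/-- linked sets -/
def Linked (c : Sym2 ℕ+ → Fin 4) (i : Fin 4) (S : Set ℕ+) : Prop :=
  ∀ X : Set ℕ+, X.Finite → ∀ u ∈ S, ∀ v ∈ S, u ∉ X → v ∉ X → Relation.ReflTransGen (lrel c i X) u v

variable {c : Sym2 ℕ+ → Fin 4} {i : Fin 4}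

theorem Linked.union {S S' : Set ℕ+} (h : Linked c i S) (h' : Linked c i S')
    (hinf : (S ∩ S').Infinite) : Linked c i (S ∪ S') := by
  intro X hX u hu v hv huX hvX
  obtain ⟨w, hw, hwX⟩ := hinf.exists_notMem_finset hX.toFinset
  have hwX' : w ∉ X := by simpa using hwX
  have h1 : Relation.ReflTransGen (lrel c i X) u w := by
    rcases hu with hu | hu
    · exact h X hX u hu w hw.1 huX hwX'
    · exact h' X hX u hu w hw.2 huX hwX'
  have h2 : Relation.ReflTransGen (lrel c i X) w v := by
    rcases hv with hu | hu
    · exact h X hX w hw.1 v hu hwX' hvX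
    · exact h' X hX w hw.2 v hu hwX' hvX
  exact h1.trans h2

theorem Linked.mono {S S' : Set ℕ+} (h : Linked c i S) (hs : S' ⊆ S) : Linked c i S' :=
  fun X hX u hu v hv => h X hX u (hs hu) v (hs hv)

theorem Linked.addNbrs {S T : Set ℕ+} (h : Linked c i S)
    (hT : ∀ v ∈ T, {w | w ∈ S ∧ c s(v, w) = i}.Infinite) : Linked c i (S ∪ T) := by
  intro X hX u hu v hv huX hvX
  have key : ∀ u ∈ S ∪ T, u ∉ X → ∃ w ∈ S, w ∉ X ∧ Relation.ReflTransGen (lrel c i X) u w ∧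
      Relation.ReflTransGen (lrel c i X) w u := by
    intro u hu huX
    rcases hu with hu | hu
    · exact ⟨u, hu, huX, .refl, .refl⟩
    · obtain ⟨w, hw, hwX⟩ := (hT u hu).exists_notMem_finset (hX.toFinset ∪ {u})
      simp only [Finset.mem_union, Set.Finite.mem_toFinset, Finset.mem_singleton, not_or] at hwX
      refine ⟨w, hw.1, hwX.1, .single ⟨fun e => hwX.2 e.symm, hw.2, hwX.1⟩,
        .single ⟨hwX.2, ?_, huX⟩⟩
      rw [Sym2.eq_swap]; exact hw.2
  obtain ⟨w, hw, hwX, p1, -⟩ := key u hu huX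
  obtain ⟨w', hw', hwX', -, p2⟩ := key v hv hvX
  exact p1.trans ((h X hX w hw w' hw' hwX hwX').trans p2)

theorem Linked.exists_max {S : Set ℕ+} (h : Linked c i S) :
    ∃ K, S ⊆ K ∧ Maximal (Linked c i) K := by
  obtain ⟨K, hK, hm⟩ := zorn_subset_nonempty {T | Linked c i T} (by
    intro C hC hch hne
    refine ⟨⋃₀ C, ?_, fun s hs => Set.subset_sUnion_of_mem hs⟩
    intro X hX u hu v hv huX hvX
    obtain ⟨A, hA, hu⟩ := hu
    obtain ⟨B, hB, hv⟩ := hv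
    rcases hch.total hA hB with e | e
    · exact hC hB X hX u (e hu) v hv huX hvX
    · exact hC hA X hX u hu v (e hv) huX hvX) S h
  exact ⟨K, hK, hm⟩

/-- nonprincipal ultrafilters -/
abbrev NPU := {U : Ultrafilter ℕ+ // (U : Filter ℕ+) ≤ cofinite}

theorem NPU.infinite (U : NPU) {s : Set ℕ+} (hs : s ∈ U.1) : s.Infinite := by
  intro hf
  have h1 : sᶜ ∈ U.1 := U.2 hf.compl_mem_cofinite
  exact (Ultrafilter.compl_mem_iff_notMem.mp h1) hs

theorem exists_NPU {s : Set ℕ+} (hs : s.Infinite) : ∃ U : NPU, s ∈ U.1 := by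
  have : NeBot (cofinite ⊓ 𝓟 s) := hs.cofinite_inf_principal_neBot
  refine ⟨⟨Ultrafilter.of (cofinite ⊓ 𝓟 s), (Ultrafilter.of_le _).trans inf_le_left⟩, ?_⟩
  exact (Ultrafilter.of_le (cofinite ⊓ 𝓟 s)) (mem_inf_of_right (mem_principal_self s))

theorem ultra_const (U : Ultrafilter ℕ+) (f : ℕ+ → Fin 4) : ∃ i, ∀ᶠ x in (U : Filter ℕ+), f x = i := by
  by_contra h
  push Not at h
  have h' : ∀ i, ∀ᶠ x in (U : Filter ℕ+), f x ≠ i := fun i =>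
    h i
  obtain ⟨x, hx⟩ := (eventually_all.mpr h').exists
  exact hx _ rfl

/-- vertices whose colour towards `W` is `i` -/
def LL (c : Sym2 ℕ+ → Fin 4) (i : Fin 4) (W : NPU) : Set ℕ+ :=
  {v | ∀ᶠ w in (W.1 : Filter ℕ+), c s(v, w) = i}

theorem LL_linked (W : NPU) : Linked c i (LL c i W) := by
  intro X hX u hu v hv huX hvX
  have hm : {w | c s(u, w) = i} ∩ {w | c s(v, w) = i} ∈ W.1 := inter_mem hu hv
  obtain ⟨w, hw, hwX⟩ := (W.infinite hm).exists_notMem_finset (hX.toFinset ∪ {u, v})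
  simp only [Finset.mem_union, Set.Finite.mem_toFinset, Finset.mem_insert, Finset.mem_singleton,
    not_or] at hwX
  refine .tail (.single ⟨fun e => hwX.2.1 e.symm, hw.1, hwX.1⟩) ⟨hwX.2.2, ?_, hvX⟩
  rw [Sym2.eq_swap]; exact hw.2

theorem LL_exists (c : Sym2 ℕ+ → Fin 4) (W : NPU) (v : ℕ+) : ∃ i, v ∈ LL c i W :=
  ultra_const W.1 (fun w => c s(v, w))

theorem LL_unique {W : NPU} {v : ℕ+} {j : Fin 4} (h : v ∈ LL c i W) (h' : v ∈ LL c j W) :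
    i = j := by
  obtain ⟨w, hw, hw'⟩ := (Filter.Eventually.and h h').exists
  exact hw.symm.trans hw'

theorem cc_exists (c : Sym2 ℕ+ → Fin 4) (V W : NPU) : ∃ i, LL c i W ∈ V.1 := by
  choose f hf using LL_exists c W
  obtain ⟨i, hi⟩ := ultra_const V.1 f
  refine ⟨i, ?_⟩
  filter_upwards [hi] with v hv
  rw [← hv]; exact hf v

/-- colour between ultrafilters -/
noncomputable def cc (c : Sym2 ℕ+ → Fin 4) (V W : NPU) : Fin 4 := (cc_exists c V W).choose

theorem cc_spec (c : Sym2 ℕ+ → Fin 4) (V W : NPU) : LL c (cc c V W) W ∈ V.1 :=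
  (cc_exists c V W).choose_spec

open Classical in
/-- class of an ultrafilter -/
noncomputable def clsU (c : Sym2 ℕ+ → Fin 4) (i : Fin 4) (V : NPU) : Option (Set ℕ+) :=
  if h : ∃ K, Maximal (Linked c i) K ∧ K ∈ V.1 then some h.choose else none

theorem max_unique {V : NPU} {K K' : Set ℕ+} (h : Maximal (Linked c i) K)
    (h' : Maximal (Linked c i) K') (hK : K ∈ V.1) (hK' : K' ∈ V.1) : K = K' := by
  have hu := h.prop.union h'.prop (V.infinite (inter_mem hK hK'))
  have e1 := h.eq_of_subset hu Set.subset_union_left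
  have e2 := h'.eq_of_subset hu Set.subset_union_right
  exact e1.trans e2.symm

theorem clsU_iff {V : NPU} {K : Set ℕ+} :
    clsU c i V = some K ↔ Maximal (Linked c i) K ∧ K ∈ V.1 := by
  unfold clsU
  split_ifs with h
  · rw [Option.some.injEq]
    constructor
    · rintro rfl; exact h.choose_spec
    · rintro ⟨h1, h2⟩
      exact max_unique h.choose_spec.1 h1 h.choose_spec.2 h2
  · constructor
    · intro h; exact absurd h (by simp)
    · intro h'; exact absurd ⟨K, h'⟩ h

theorem clsU_of_linked {V : NPU} {S : Set ℕ+} (h : Linked c i S) (hS : S ∈ V.1) :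
    ∃ K, clsU c i V = some K ∧ S ⊆ K := by
  obtain ⟨K, hSK, hK⟩ := h.exists_max
  exact ⟨K, clsU_iff.2 ⟨hK, mem_of_superset hS hSK⟩, hSK⟩

/-- the system associated with a colouring -/
noncomputable def sysOf (c : Sym2 ℕ+ → Fin 4) : Sys NPU (Set ℕ+) where
  c := cc c
  cls := clsU c
  a1 := fun V W => by
    obtain ⟨K, hK, -⟩ := clsU_of_linked (LL_linked W) (cc_spec c V W)
    exact ⟨K, hK⟩
  a2 := fun i V V' W h h' => by
    subst h
    obtain ⟨K, hK, hs⟩ := clsU_of_linked (LL_linked W) (cc_spec c V W)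
    have hV' := cc_spec c V' W
    rw [h'] at hV'
    rw [hK, eq_comm, clsU_iff]
    exact ⟨(clsU_iff.1 hK).1, mem_of_superset hV' hs⟩
  a3 := fun i V W K h hW => by
    subst h
    have hV := cc_spec c V W
    obtain ⟨hm, hKW⟩ := clsU_iff.1 hW
    have hl : Linked c (cc c V W) (K ∪ LL c (cc c V W) W) := hm.prop.addNbrs (fun v hv =>
      W.infinite (inter_mem hKW hv))
    have e := hm.eq_of_subset hl Set.subset_union_left
    rw [clsU_iff]
    refine ⟨hm, mem_of_superset hV ?_⟩
    rw [e]; exact Set.subset_union_right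

theorem linked_nbrs {K : Set ℕ+} (h : Linked c i K) (hinf : K.Infinite) {v : ℕ+} (hv : v ∈ K) :
    {w | w ≠ v ∧ c s(v, w) = i}.Infinite := by
  intro hf
  obtain ⟨u, hu, huX⟩ := hinf.exists_notMem_finset (hf.toFinset ∪ {v})
  simp only [Finset.mem_union, Set.Finite.mem_toFinset, Finset.mem_singleton, not_or] at huX
  have hp := h _ hf v hv u hu (by simp) huX.1
  rcases Relation.ReflTransGen.cases_head hp with e | ⟨w, hw, -⟩
  · exact huX.2 e.symm
  · exact hw.2.2 ⟨hw.1.symm, hw.2.1⟩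

theorem sysOf_a4 (c : Sym2 ℕ+ → Fin 4) : ∀ U i, (∀ j, j ≠ i → (sysOf c).cls j U = none) → ∀ V q,
    (sysOf c).cls i V = some q → (sysOf c).cls i U = some q := by
  intro U i hU V K hV
  have hcc : ∀ W, cc c U W = i := by
    intro W
    by_contra hx
    obtain ⟨q, hq⟩ := (sysOf c).a1 U W
    have := hU _ hx
    rw [show (sysOf c).c U W = cc c U W from rfl, this] at hq
    exact absurd hq (by simp)
  obtain ⟨K0, hK0, -⟩ := clsU_of_linked (LL_linked U) (cc_spec c U U)
  rw [hcc] at hK0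
  obtain ⟨hm, hKV⟩ := clsU_iff.1 hV
  obtain ⟨hm0, hKU⟩ := clsU_iff.1 hK0
  have hsub : K ⊆ K0 := by
    intro v hv
    obtain ⟨W, hW⟩ := exists_NPU (linked_nbrs hm.prop (V.infinite hKV) hv)
    have hvL : v ∈ LL c i W := by
      filter_upwards [hW] with w hw using hw.2
    have hUL := cc_spec c U W
    rw [hcc] at hUL
    obtain ⟨K1, hK1, hs1⟩ := clsU_of_linked (LL_linked W) hUL
    rw [hK0] at hK1
    rw [Option.some.inj hK1]
    exact hs1 hvL
  have e := hm.eq_of_subset hm0.prop hsub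
  show clsU c i U = some K
  rw [hK0, e]

/-! ### Building infinite paths -/

/-- adjacency in colour `i` -/
def cadj (c : Sym2 ℕ+ → Fin 4) (i : Fin 4) (u v : ℕ+) : Prop := u ≠ v ∧ c s(u, v) = i

theorem extract_path {c : Sym2 ℕ+ → Fin 4} {i : Fin 4} {X : Set ℕ+} {u v : ℕ+}
    (h : Relation.ReflTransGen (lrel c i X) u v) :
    ∃ l : List ℕ+, (u :: l).Nodup ∧ (u :: l).IsChain (cadj c i) ∧ (u :: l).getLast? = some v ∧
      ∀ x ∈ l, x ∉ X := by
  induction h using Relation.ReflTransGen.head_induction_on with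
  | refl => exact ⟨[], by simp, by simp, by simp, by simp⟩
  | @head u w huw hwv ih =>
    obtain ⟨l, hn, hc, hl, hX⟩ := ih
    by_cases hu : u ∈ w :: l
    · obtain ⟨s, t, hst⟩ := List.append_of_mem hu
      rw [hst] at hn hc hl
      refine ⟨t, (List.nodup_append.1 hn).2.1, (List.isChain_append.1 hc).2.1, ?_, ?_⟩
      · rw [List.getLast?_append] at hl
        simpa [List.getLast?_cons] using hl
      · intro x hx
        have hx' : x ∈ w :: l := by rw [hst]; simp [hx]
        rcases List.mem_cons.1 hx' with rfl | hx'
        · exact huw.2.2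
        · exact hX x hx'
    · refine ⟨w :: l, List.nodup_cons.2 ⟨hu, hn⟩, ?_, ?_, ?_⟩
      · exact List.isChain_cons_cons.2 ⟨⟨huw.1, huw.2.1⟩, hc⟩
      · rw [List.getLast?_cons_cons]; exact hl
      · intro x hx
        rcases List.mem_cons.1 hx with rfl | hx
        · exact huw.2.2
        · exact hX x hx

/-- a path block with both ends in `K` -/
def IsBlock (c : Sym2 ℕ+ → Fin 4) (i : Fin 4) (K : Set ℕ+) (b : List ℕ+) : Prop :=
  b.IsChain (cadj c i) ∧ (∃ v ∈ K, b.head? = some v) ∧ (∃ v ∈ K, b.getLast? = some v)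

theorem connect {c : Sym2 ℕ+ → Fin 4} {i : Fin 4} {K : Set ℕ+} (hK : Linked c i K)
    (B : List (List ℕ+)) : ∀ (p : List ℕ+), p.Nodup → p.IsChain (cadj c i) →
      (∃ u ∈ K, p.getLast? = some u) → (∀ b ∈ B, IsBlock c i K b) → (p ++ B.flatten).Nodup →
      ∃ p' : List ℕ+, p <+: p' ∧ p'.Nodup ∧ p'.IsChain (cadj c i) ∧
      (∃ u ∈ K, p'.getLast? = some u) ∧ ∀ x ∈ B.flatten, x ∈ p' := by
  induction B with
  | nil => intro p h1 h2 h3 _ _; exact ⟨p, List.prefix_rfl, h1, h2, h3, by simp⟩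
  | cons b B ih =>
    intro p h1 h2 h3 hB hn
    obtain ⟨u, huK, hu⟩ := h3
    obtain ⟨hbc, ⟨v, hvK, hv⟩, ⟨w, hwK, hw⟩⟩ := hB b (by simp)
    obtain ⟨q, rfl⟩ : ∃ q, p = q ++ [u] := List.getLast?_eq_some_iff.1 hu
    obtain ⟨t, rfl⟩ : ∃ t, b = v :: t := List.head?_eq_some_iff.1 hv
    rw [List.flatten_cons] at hn
    set Y := B.flatten with hY
    set X : Set ℕ+ := {x | x ∈ q ++ t ++ Y} with hX
    have hXf : X.Finite := List.finite_toSet _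
    have huX : u ∉ X := by
      simp only [hX, Set.mem_ofPred_eq]
      grind
    have hvX : v ∉ X := by
      simp only [hX, Set.mem_ofPred_eq]
      grind
    have huv : u ≠ v := by grind
    obtain ⟨l, ln, lc, ll, lX⟩ := extract_path (hK X hXf u huK v hvK huX hvX)
    have hlne : l ≠ [] := by
      rintro rfl
      simp at ll
      exact huv ll
    obtain ⟨m, rfl⟩ : ∃ m, l = m ++ [v] := by
      apply List.getLast?_eq_some_iff.1
      rw [List.getLast?_cons] at ll
      cases hl : l.getLast? with
      | none => exact absurd (List.getLast?_eq_none_iff.1 hl) hlne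
      | some z => simpa [hl] using ll
    have hmX : ∀ x ∈ m, x ∉ q ∧ x ∉ t ∧ x ∉ Y := by
      intro x hx
      have := lX x (by simp [hx])
      simp only [hX, Set.mem_ofPred_eq, List.mem_append, not_or] at this
      tauto
    have hnd : (q ++ [u] ++ m ++ v :: t ++ Y).Nodup := by
      have e : (q ++ [u] ++ m ++ v :: t ++ Y).Perm (m ++ (q ++ [u] ++ (v :: t ++ Y))) := by
        simpa [List.append_assoc] using (List.perm_append_comm_assoc (q ++ [u]) m (v :: t ++ Y))
      rw [e.nodup_iff, List.nodup_append]
      refine ⟨by grind, hn, ?_⟩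
      intro x hx y hy hxy
      subst hxy
      have := hmX x hx
      grind
    have hch : (q ++ [u] ++ m ++ v :: t).IsChain (cadj c i) := by
      rw [List.isChain_split]
      refine ⟨?_, hbc⟩
      have : q ++ [u] ++ m ++ [v] = q ++ u :: (m ++ [v]) := by simp
      rw [this, List.isChain_split]
      exact ⟨h2, lc⟩
    obtain ⟨p', g1, g2, g3, g4, g5⟩ := ih (q ++ [u] ++ m ++ v :: t)
      (List.nodup_append.1 hnd).1 hch ⟨w, hwK, by
        rw [List.getLast?_append, hw]; rfl⟩ (fun b hb => hB b (by simp [hb])) hnd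
    refine ⟨p', ?_, g2, g3, g4, ?_⟩
    · refine List.IsPrefix.trans ?_ g1
      rw [List.append_assoc]
      exact List.prefix_append _ _
    · intro x hx
      rw [List.flatten_cons, List.mem_append] at hx
      rcases hx with hx | hx
      · exact g1.subset (by simp only [List.mem_append]; exact Or.inr hx)
      · exact g5 x hx

theorem finite_le (A : Set ℕ+) (n : ℕ) : {a : ℕ+ | a ∈ A ∧ (a : ℕ) ≤ n}.Finite := by
  apply Set.Finite.subset (Set.finite_Iic (⟨n + 1, Nat.succ_pos n⟩ : ℕ+))
  rintro a ⟨-, ha⟩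
  have h : (a : ℕ) ≤ ((⟨n + 1, Nat.succ_pos n⟩ : ℕ+) : ℕ) := ha.trans (Nat.le_succ n)
  exact PNat.coe_le_coe _ _ |>.1 h

theorem card_le_n (A : Set ℕ+) (n : ℕ) : Nat.card {a : ℕ+ // a ∈ A ∧ (a : ℕ) ≤ n} ≤ n := by
  have h : Function.Injective (fun a : {a : ℕ+ // a ∈ A ∧ (a : ℕ) ≤ n} =>
      (⟨(a.1 : ℕ) - 1, by have := a.1.pos; have := a.2.2; omega⟩ : Fin n)) := by
    intro a b hab
    simp only [Fin.mk.injEq] at hab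
    have := a.1.pos
    have := b.1.pos
    apply Subtype.ext
    apply PNat.coe_injective
    omega
  have := Nat.card_le_card_of_injective _ h
  simpa using this

theorem le_upperDensity {A : Set ℕ+} {κ : ℝ}
    (h : ∀ N : ℕ, ∃ n : ℕ, N ≤ n ∧ 0 < n ∧
      κ * n ≤ Nat.card {a : ℕ+ // a ∈ A ∧ (a : ℕ) ≤ n}) : κ ≤ upperDensity A := by
  unfold upperDensity
  apply Filter.le_limsup_of_frequently_le
  · rw [Filter.frequently_atTop]
    intro N
    obtain ⟨n, hn, h0, hc⟩ := h N
    refine ⟨n, hn, ?_⟩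
    rw [le_div_iff₀ (by exact_mod_cast h0)]
    exact hc
  · refine ⟨1, ?_⟩
    simp only [Filter.eventually_map]
    refine Filter.Eventually.of_forall fun n => ?_
    rcases Nat.eq_zero_or_pos n with rfl | h0
    · simp
    · rw [div_le_one (by exact_mod_cast h0)]
      exact_mod_cast card_le_n A n

theorem build_path {c : Sym2 ℕ+ → Fin 4} {i : Fin 4} {K : Set ℕ+} (hK : Linked c i K) {κ : ℝ}
    (hκ : 0 < κ)
    (h : ∀ N : ℕ, ∃ n : ℕ, N ≤ n ∧ 0 < n ∧ ∃ B : List (List ℕ+), (∀ b ∈ B, IsBlock c i K b) ∧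
      B.flatten.Nodup ∧ (∀ x ∈ B.flatten, N < (x : ℕ)) ∧
      κ * n ≤ (B.flatten.filter (fun x : ℕ+ => (x : ℕ) ≤ n)).length) :
    ∃ P : Set ℕ+, IsMonoPath completeAdj c i P ∧ κ ≤ upperDensity P := by
  classical
  let St := {p : List ℕ+ // p.Nodup ∧ p.IsChain (cadj c i) ∧ ∃ u ∈ K, p.getLast? = some u}
  have next : ∀ (p : St) (N : ℕ), ∃ p' : St, p.1 <+: p'.1 ∧ p.1.length < p'.1.length ∧
      ∃ n : ℕ, N ≤ n ∧ 0 < n ∧ κ * n ≤ (p'.1.filter (fun x : ℕ+ => (x : ℕ) ≤ n)).length := by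
    rintro ⟨p, hp1, hp2, hp3⟩ N
    obtain ⟨n, hn, h0, B, hB, hBn, hBN, hBc⟩ := h (N + (p.map (fun x : ℕ+ => (x : ℕ))).sum)
    have hlt : ∀ x ∈ p, ∀ y ∈ B.flatten, x ≠ y := by
      intro x hx y hy e
      subst e
      have h1 := hBN x hy
      have h2 : (x : ℕ) ≤ (p.map (fun x : ℕ+ => (x : ℕ))).sum :=
        List.le_sum_of_mem (List.mem_map.2 ⟨x, hx, rfl⟩)
      omega
    have hnd : (p ++ B.flatten).Nodup := List.nodup_append.2 ⟨hp1, hBn, hlt⟩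
    obtain ⟨p', g1, g2, g3, g4, g5⟩ := connect hK B p hp1 hp2 hp3 hB hnd
    refine ⟨⟨p', g2, g3, g4⟩, g1, ?_, n, by omega, h0, ?_⟩
    · have hne : B.flatten ≠ [] := by
        intro e
        rw [e] at hBc
        simp only [List.filter_nil, List.length_nil, Nat.cast_zero] at hBc
        have : (0 : ℝ) < κ * n := mul_pos hκ (by exact_mod_cast h0)
        linarith
      obtain ⟨y, hy⟩ := List.exists_mem_of_ne_nil _ hne
      have hle := g1.length_le
      rcases hle.lt_or_eq with e | e
      · exact e
      · exfalso
        have := g1.eq_of_length e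
        subst this
        exact hlt y (g5 y hy) y hy rfl
    · refine hBc.trans ?_
      have hsub : (B.flatten.filter (fun x : ℕ+ => (x : ℕ) ≤ n)).toFinset ⊆
          (p'.filter (fun x : ℕ+ => (x : ℕ) ≤ n)).toFinset := by
        intro x hx
        simp only [List.mem_toFinset, List.mem_filter] at hx ⊢
        exact ⟨g5 x hx.1, hx.2⟩
      have := Finset.card_le_card hsub
      rw [List.toFinset_card_of_nodup (hBn.filter _), List.toFinset_card_of_nodup (g2.filter _)]
        at this
      exact_mod_cast this
  have init : Nonempty St := by
    obtain ⟨n, hn, h0, B, hB, hBn, hBN, hBc⟩ := h 0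
    cases B with
    | nil =>
      simp only [List.flatten_nil, List.filter_nil, List.length_nil, Nat.cast_zero] at hBc
      have : (0 : ℝ) < κ * n := mul_pos hκ (by exact_mod_cast h0)
      linarith
    | cons b B =>
      obtain ⟨-, ⟨v, hv, -⟩, -⟩ := hB b (by simp)
      exact ⟨⟨[v], by simp, by simp, v, hv, by simp⟩⟩
  obtain ⟨p0⟩ := init
  choose nx nx1 nx2 nx3 using next
  let P : ℕ → St := fun k => Nat.rec p0 (fun k p => nx p k) k
  have Psucc : ∀ k, P (k + 1) = nx (P k) k := fun k => rfl
  have Ppre : ∀ k m, k ≤ m → (P k).1 <+: (P m).1 := by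
    intro k m hkm
    induction hkm with
    | refl => exact List.prefix_rfl
    | step _ ih => exact ih.trans (nx1 _ _)
  have Plen : ∀ k, k < (P k).1.length := by
    intro k
    induction k with
    | zero =>
      obtain ⟨u, -, hu⟩ := (P 0).2.2.2
      by_contra hx
      have : (P 0).1 = [] := List.length_eq_zero_iff.1 (by omega)
      rw [this] at hu
      simp at hu
    | succ k ih =>
      have := nx2 (P k) k
      rw [← Psucc] at this
      omega
  let f : ℕ → ℕ+ := fun j => (P j).1[j]'(Plen j)
  have hf : ∀ m j, (hj : j < (P m).1.length) → (P m).1[j] = f j := by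
    intro m j hj
    rcases le_total m j with e | e
    · exact (Ppre m j e).getElem hj
    · exact ((Ppre j m e).getElem (Plen j)).symm
  refine ⟨Set.range f, Or.inr ⟨f, ?_, ?_, rfl⟩, ?_⟩
  · intro a b hab
    have ha : a < (P (max a b)).1.length := lt_of_le_of_lt (le_max_left a b) (Plen _)
    have hb : b < (P (max a b)).1.length := lt_of_le_of_lt (le_max_right a b) (Plen _)
    rw [← hf _ a ha, ← hf _ b hb] at hab
    exact ((P (max a b)).2.1.getElem_inj_iff).1 hab
  · intro j
    have h1 := Plen (j + 1)
    have := List.isChain_iff_getElem.1 (P (j + 1)).2.2.1 j h1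
    have e1 := hf (j + 1) j (by omega)
    have e2 := hf (j + 1) (j + 1) h1
    rw [← e1, ← e2]
    exact this
  · apply le_upperDensity
    intro N
    obtain ⟨n, hn, h0, hc⟩ := nx3 (P N) N
    refine ⟨n, hn, h0, hc.trans ?_⟩
    rw [← Psucc]
    have hsub : (((P (N + 1)).1.filter (fun x : ℕ+ => (x : ℕ) ≤ n)).toFinset : Set ℕ+) ⊆
        {a : ℕ+ | a ∈ Set.range f ∧ (a : ℕ) ≤ n} := by
      intro x hx
      simp only [List.coe_toFinset, List.mem_filter, Set.mem_ofPred_eq] at hx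
      obtain ⟨m, hm, rfl⟩ := List.getElem_of_mem hx.1
      refine ⟨⟨m, (hf (N + 1) m hm).symm⟩, by simpa using hx.2⟩
    have h1 := Set.ncard_le_ncard hsub (finite_le _ n)
    rw [Set.ncard_coe_finset, List.toFinset_card_of_nodup ((P (N + 1)).2.1.filter _)] at h1
    rw [← Nat.card_coe_set_eq] at h1
    exact_mod_cast h1

/-- consequence for dense linked sets -/
theorem linked_dense {c : Sym2 ℕ+ → Fin 4} {i : Fin 4} {K : Set ℕ+} (hK : Linked c i K) {κ κ' : ℝ}
    (hκ : 0 < κ) (hκ' : κ < κ')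
    (h : ∀ N : ℕ, ∃ n : ℕ, N ≤ n ∧ κ' * n ≤ {a : ℕ+ | a ∈ K ∧ (a : ℕ) ≤ n}.ncard) :
    ∃ P : Set ℕ+, IsMonoPath completeAdj c i P ∧ κ ≤ upperDensity P := by
  classical
  apply build_path hK hκ
  intro N
  obtain ⟨M, hM⟩ := exists_nat_gt ((N : ℝ) / (κ' - κ))
  obtain ⟨n, hn, hc⟩ := h (N + M + 1)
  refine ⟨n, by omega, by omega, ?_⟩
  have hfin : {a : ℕ+ | (a ∈ K ∧ N < (a : ℕ)) ∧ (a : ℕ) ≤ n}.Finite :=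
    finite_le {a | a ∈ K ∧ N < (a : ℕ)} n
  have hfl : ∀ l : List ℕ+, (l.map (fun x => [x])).flatten = l := by
    intro l; induction l with
    | nil => rfl
    | cons a l ih => simpa using ih
  refine ⟨hfin.toFinset.toList.map (fun x => [x]), ?_, ?_, ?_, ?_⟩
  · intro b hb
    simp only [List.mem_map, Finset.mem_toList, Set.Finite.mem_toFinset] at hb
    obtain ⟨x, hx, rfl⟩ := hb
    exact ⟨by simp, ⟨x, hx.1.1, by simp⟩, ⟨x, hx.1.1, by simp⟩⟩
  · rw [hfl]; exact Finset.nodup_toList _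
  · rw [hfl]
    intro x hx
    simp only [Finset.mem_toList, Set.Finite.mem_toFinset] at hx
    exact hx.1.2
  · rw [hfl, List.filter_eq_self.2, Finset.length_toList]
    swap
    · intro x hx
      simp only [Finset.mem_toList, Set.Finite.mem_toFinset] at hx
      simpa using hx.2
    have hsub : {a : ℕ+ | a ∈ K ∧ (a : ℕ) ≤ n} ⊆
        (hfin.toFinset : Set ℕ+) ∪ {a : ℕ+ | a ∈ Set.univ ∧ (a : ℕ) ≤ N} := by
      rintro a ⟨h1, h2⟩
      by_cases hx : (a : ℕ) ≤ N
      · exact Or.inr ⟨trivial, hx⟩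
      · left
        simp only [Set.Finite.coe_toFinset]
        exact ⟨⟨h1, by omega⟩, h2⟩
    have h1 := Set.ncard_le_ncard hsub ((Finset.finite_toSet _).union (finite_le _ N))
    have h2 := Set.ncard_union_le (hfin.toFinset : Set ℕ+) {a : ℕ+ | a ∈ Set.univ ∧ (a : ℕ) ≤ N}
    have h3 := card_le_n Set.univ N
    rw [Set.ncard_coe_finset] at h2
    have h3' : {a : ℕ+ | a ∈ Set.univ ∧ (a : ℕ) ≤ N}.ncard ≤ N := h3
    have h4 : {a : ℕ+ | a ∈ K ∧ (a : ℕ) ≤ n}.ncard ≤ hfin.toFinset.card + N := by omega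
    have h4' : ({a : ℕ+ | a ∈ K ∧ (a : ℕ) ≤ n}.ncard : ℝ) ≤ hfin.toFinset.card + N := by
      exact_mod_cast h4
    have h5 : (N : ℝ) ≤ (κ' - κ) * n := by
      rw [div_lt_iff₀ (by linarith)] at hM
      have : (M : ℝ) ≤ n := by exact_mod_cast (by omega : M ≤ n)
      nlinarith
    linarith

/-! ### A finite counting lemma -/

open Classical in
theorem fiber_sq {α : Type*} (B : Finset α) (g : α → Fin 4) (C : Finset (Fin 4))
    (hg : ∀ b ∈ B, g b ∈ C) :
    B.card ^ 2 ≤ C.card * ∑ b ∈ B, (B.filter (fun b' => g b' = g b)).card := by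
  have h1 : ∑ b ∈ B, (B.filter (fun b' => g b' = g b)).card =
      ∑ t ∈ C, (B.filter (fun b' => g b' = t)).card ^ 2 := by
    rw [← Finset.sum_fiberwise_of_maps_to hg]
    refine Finset.sum_congr rfl fun t _ => ?_
    rw [sq]
    rw [← smul_eq_mul, ← Finset.sum_const]
    refine Finset.sum_congr rfl fun b hb => ?_
    rw [(Finset.mem_filter.1 hb).2]
  rw [h1, Finset.card_eq_sum_card_fiberwise hg]
  exact sq_sum_le_card_mul_sum_sq

open Classical in
theorem gyarfas (Z : Finset ℕ+) (F : Finset (Fin 4 × Set ℕ+)) (C : Finset (Fin 4)) (s : ℕ)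
    (hs : 1 ≤ s) (hC : C.card = s + 1) (hF : ∀ q ∈ F, q.1 ∈ C)
    (hu : ∀ z ∈ Z, ∀ q ∈ F, ∀ q' ∈ F, z ∈ q.2 → z ∈ q'.2 → q.1 = q'.1 → q = q')
    (hp : ∀ z ∈ Z, ∀ z' ∈ Z, ∃ q ∈ F, z ∈ q.2 ∧ z' ∈ q.2) (hZ : Z.Nonempty) :
    ∃ q ∈ F, Z.card ≤ s * (Z.filter (fun z => z ∈ q.2)).card := by
  by_contra hcon
  push Not at hcon
  obtain ⟨z0, hz0⟩ := hZ
  obtain ⟨q0, hq0, hz0q, -⟩ := hp z0 hz0 z0 hz0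
  set A := Z.filter (fun z => z ∈ q0.2) with hA
  set B := Z.filter (fun z => z ∉ q0.2) with hB
  have hAB : A.card + B.card = Z.card := Finset.card_filter_add_card_filter_not (s := Z) _
  have hApos : 0 < A.card := Finset.card_pos.2 ⟨z0, by simp [hA, hz0, hz0q]⟩
  have hBpos : 0 < B.card := by
    by_contra hx
    have h1 := hcon q0 hq0
    have h2 : Z.card = A.card := by omega
    have h3 : A.card ≤ s * A.card := Nat.le_mul_of_pos_left _ hs
    rw [← hA] at h1
    omega
  have hq : ∀ a b : ℕ+, ∃ q : Fin 4 × Set ℕ+, a ∈ A → b ∈ B → q ∈ F ∧ a ∈ q.2 ∧ b ∈ q.2 := by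
    intro a b
    by_cases hab : a ∈ A ∧ b ∈ B
    · obtain ⟨q, h1, h2, h3⟩ := hp a (Finset.mem_filter.1 hab.1).1 b (Finset.mem_filter.1 hab.2).1
      exact ⟨q, fun _ _ => ⟨h1, h2, h3⟩⟩
    · exact ⟨q0, fun h1 h2 => absurd ⟨h1, h2⟩ hab⟩
  choose q hq using hq
  have hcol : ∀ a ∈ A, ∀ b ∈ B, (q a b).1 ∈ C.erase q0.1 := by
    intro a ha b hb
    obtain ⟨h1, h2, h3⟩ := hq a b ha hb
    rw [Finset.mem_erase]
    refine ⟨fun e => ?_, hF _ h1⟩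
    have := hu a (Finset.mem_filter.1 ha).1 _ h1 _ hq0 h2 (Finset.mem_filter.1 ha).2 e
    rw [this] at h3
    exact (Finset.mem_filter.1 hb).2 h3
  have hCe : (C.erase q0.1).card = s := by
    rw [Finset.card_erase_of_mem (hF _ hq0), hC]; rfl
  -- lower bounds
  have lowB : ∀ a ∈ A, B.card ^ 2 ≤ s * ∑ b ∈ B, (B.filter (fun z => z ∈ (q a b).2)).card := by
    intro a ha
    have h1 := fiber_sq B (fun b => (q a b).1) (C.erase q0.1) (hcol a ha)
    rw [hCe] at h1
    refine h1.trans (Nat.mul_le_mul_left _ (Finset.sum_le_sum fun b hb => Finset.card_le_card ?_))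
    intro b' hb'
    rw [Finset.mem_filter] at hb' ⊢
    refine ⟨hb'.1, ?_⟩
    obtain ⟨h1, h2, h3⟩ := hq a b ha hb
    obtain ⟨h1', h2', h3'⟩ := hq a b' ha hb'.1
    have := hu a (Finset.mem_filter.1 ha).1 _ h1' _ h1 h2' h2 hb'.2
    rw [← this]; exact h3'
  have lowA : ∀ b ∈ B, A.card ^ 2 ≤ s * ∑ a ∈ A, (A.filter (fun z => z ∈ (q a b).2)).card := by
    intro b hb
    have h1 := fiber_sq A (fun a => (q a b).1) (C.erase q0.1) (fun a ha => hcol a ha b hb)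
    rw [hCe] at h1
    refine h1.trans (Nat.mul_le_mul_left _ (Finset.sum_le_sum fun a ha => Finset.card_le_card ?_))
    intro a' ha'
    rw [Finset.mem_filter] at ha' ⊢
    refine ⟨ha'.1, ?_⟩
    obtain ⟨h1, h2, h3⟩ := hq a b ha hb
    obtain ⟨h1', h2', h3'⟩ := hq a' b ha'.1 hb
    have := hu b (Finset.mem_filter.1 hb).1 _ h1' _ h1 h3' h3 ha'.2
    rw [← this]; exact h2'
  have sB := Finset.sum_le_sum lowB
  have sA := Finset.sum_le_sum lowA
  rw [Finset.sum_const, smul_eq_mul, ← Finset.mul_sum] at sA sB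
  rw [Finset.sum_comm] at sA
  have tot : ∑ a ∈ A, ∑ b ∈ B, s * (Z.filter (fun z => z ∈ (q a b).2)).card <
      ∑ a ∈ A, ∑ b ∈ B, Z.card := by
    apply Finset.sum_lt_sum_of_nonempty (Finset.card_pos.1 hApos)
    intro a ha
    apply Finset.sum_lt_sum_of_nonempty (Finset.card_pos.1 hBpos)
    intro b hb
    exact hcon _ (hq a b ha hb).1
  have eqZ : ∀ a b, (Z.filter (fun z => z ∈ (q a b).2)).card =
      (A.filter (fun z => z ∈ (q a b).2)).card + (B.filter (fun z => z ∈ (q a b).2)).card := by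
    intro a b
    rw [← Finset.card_filter_add_card_filter_not (s := Z.filter (fun z => z ∈ (q a b).2))
      (fun z => z ∈ q0.2), hA, hB, Finset.filter_comm, Finset.filter_comm (s := Z)
        (p := fun z => z ∉ q0.2)]
  simp only [eqZ, ← Finset.mul_sum, Finset.sum_add_distrib, Finset.sum_const, smul_eq_mul, mul_add]
    at tot
  have : A.card * B.card ^ 2 + B.card * A.card ^ 2 = A.card * (B.card * Z.card) := by
    rw [← hAB]; ring
  have e2 : B.card * (A.card * Z.card) = A.card * (B.card * Z.card) := by ring
  omega

/-! ### Initial segments -/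

/-- `{1,…,n}` -/
def seg (n : ℕ) : Finset ℕ+ :=
  (Finset.range n).map ⟨Nat.succPNat, Nat.succPNat_injective⟩

theorem mem_seg {n : ℕ} {a : ℕ+} : a ∈ seg n ↔ (a : ℕ) ≤ n := by
  simp only [seg, Finset.mem_map, Finset.mem_range, Function.Embedding.coeFn_mk]
  constructor
  · rintro ⟨k, hk, rfl⟩
    simp only [Nat.succPNat_coe]; omega
  · intro h
    have := a.pos
    exact ⟨a.natPred, by rw [PNat.natPred]; omega, PNat.succPNat_natPred a⟩

theorem card_seg (n : ℕ) : (seg n).card = n := by simp [seg]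

open Classical in
/-- all linked sets are sparse -/
def SparseH (c : Sym2 ℕ+ → Fin 4) (κ : ℝ) : Prop := ∀ i K, Linked c i K →
  ∃ N : ℕ, ∀ n, N ≤ n → (((seg n).filter (fun a => a ∈ K)).card : ℝ) < κ * n

theorem of_not_sparse {c : Sym2 ℕ+ → Fin 4} {κ κ' : ℝ} (hκ : 0 < κ) (hκ' : κ < κ')
    (h : ¬ SparseH c κ') : ∃ (i : Fin 4) (P : Set ℕ+),
      IsMonoPath completeAdj c i P ∧ κ ≤ upperDensity P := by
  classical
  unfold SparseH at h
  push Not at h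
  obtain ⟨i, K, hK, hN⟩ := h
  refine ⟨i, linked_dense hK hκ hκ' fun N => ?_⟩
  obtain ⟨n, hn, hc⟩ := hN N
  refine ⟨n, hn, hc.trans ?_⟩
  rw [← Set.ncard_coe_finset]
  have : (((seg n).filter (fun a => a ∈ K) : Finset ℕ+) : Set ℕ+) =
      {a : ℕ+ | a ∈ K ∧ (a : ℕ) ≤ n} := by
    ext a
    simp [mem_seg, and_comm]
  rw [← this]

/-! ### A cover contradicts sparsity -/

theorem sum_list_swap {α : Type*} (s : Finset ℕ+) (L : List α) (f : α → ℕ+ → ℕ) :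
    ∑ v ∈ s, (L.map (fun p => f p v)).sum = (L.map (fun p => ∑ v ∈ s, f p v)).sum := by
  induction L with
  | nil => simp
  | cons a L ih => simp [Finset.sum_add_distrib, ih]

theorem cover_false {c : Sym2 ℕ+ → Fin 4} {κ : ℝ} (hκ0 : 0 < κ) (hκ : κ < 1 / 3)
    (h : SparseH c κ) (hc : (sysOf c).Cover) : False := by
  classical
  obtain ⟨L, hL, hcov⟩ := hc
  let f : Fin 4 × Set ℕ+ → ℕ+ → ℕ := fun p v => indP (Maximal (Linked c p.1) p.2 ∧ v ∈ p.2)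
  have hF0 : {v | ¬ 4 ≤ (L.map (fun p => f p v)).sum}.Finite := by
    by_contra hinf
    obtain ⟨V, hV⟩ := exists_NPU hinf
    have hev : ∀ L' : List (Fin 4 × Set ℕ+), ∀ᶠ v in (V.1 : Filter ℕ+),
        (L'.map (fun p => f p v)).sum =
          (L'.map (fun p => indP ((sysOf c).cls p.1 V = some p.2))).sum := by
      intro L'
      induction L' with
      | nil => simp
      | cons p L' ih =>
        have : ∀ᶠ v in (V.1 : Filter ℕ+), (v ∈ p.2 ↔ p.2 ∈ V.1) := by
          by_cases hp : p.2 ∈ V.1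
          · filter_upwards [hp] with v hv; simp [hv, hp]
          · filter_upwards [Ultrafilter.compl_mem_iff_notMem.2 hp] with v hv
            simp only [hp, iff_false]; exact hv
        filter_upwards [ih, this] with v h1 h2
        simp only [List.map_cons, List.sum_cons, h1]
        congr 1
        show indP _ = indP (clsU c p.1 V = some p.2)
        rw [clsU_iff, h2]
    obtain ⟨v, hv, hv'⟩ := ((hev L).and hV).exists
    exact hv' (by rw [hv]; exact hcov V)
  have hbd : ∀ L' : List (Fin 4 × Set ℕ+), ∃ N : ℕ, ∀ n, N ≤ n →
      (((L'.map (fun p => ∑ v ∈ seg n, f p v)).sum : ℕ) : ℝ) ≤ L'.length * (κ * n) := by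
    intro L'
    induction L' with
    | nil => exact ⟨0, by simp⟩
    | cons p L' ih =>
      obtain ⟨N, hN⟩ := ih
      by_cases hp : Maximal (Linked c p.1) p.2
      · obtain ⟨N', hN'⟩ := h p.1 p.2 hp.prop
        refine ⟨N + N', fun n hn => ?_⟩
        have h1 := hN n (by omega)
        have h2 := hN' n (by omega)
        have h3 : ∑ v ∈ seg n, f p v = ((seg n).filter (fun a => a ∈ p.2)).card := by
          rw [Finset.card_filter]
          refine Finset.sum_congr rfl fun v _ => ?_
          simp only [f, indP, hp, true_and]
        simp only [List.map_cons, List.sum_cons, List.length_cons, h3]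
        rw [Nat.cast_add, Nat.cast_succ]
        have h2' : (((seg n).filter (fun a => a ∈ p.2)).card : ℝ) < κ * n := by
          convert h2
        linarith
      · refine ⟨N, fun n hn => ?_⟩
        have h1 := hN n hn
        have h3 : ∑ v ∈ seg n, f p v = 0 := by
          refine Finset.sum_eq_zero fun v _ => ?_
          simp only [f, indP, hp, false_and, if_false]
        simp only [List.map_cons, List.sum_cons, List.length_cons, h3]
        rw [Nat.cast_add, Nat.cast_succ, Nat.cast_zero]
        have : 0 ≤ κ * n := by positivity
        linarith
  obtain ⟨N, hN⟩ := hbd L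
  obtain ⟨M, hM⟩ := exists_nat_gt ((4 * hF0.toFinset.card : ℝ) / (4 - 12 * κ))
  have h1 := hN (N + M) (by omega)
  rw [← sum_list_swap] at h1
  have h2 : 4 * ((seg (N + M)).card - hF0.toFinset.card) ≤
      ∑ v ∈ seg (N + M), (L.map (fun p => f p v)).sum := by
    calc 4 * ((seg (N + M)).card - hF0.toFinset.card)
        ≤ 4 * (seg (N + M) \ hF0.toFinset).card :=
          Nat.mul_le_mul_left _ (Finset.le_card_sdiff _ _)
      _ = ∑ v ∈ seg (N + M) \ hF0.toFinset, 4 := by simp [mul_comm]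
      _ ≤ ∑ v ∈ seg (N + M) \ hF0.toFinset, (L.map (fun p => f p v)).sum := by
          refine Finset.sum_le_sum fun v hv => ?_
          by_contra hx
          exact (Finset.mem_sdiff.1 hv).2 (by simpa using hx)
      _ ≤ _ := Finset.sum_le_sum_of_subset Finset.sdiff_subset
  rw [card_seg] at h2
  have h3 : 4 * (N + M) ≤ ∑ v ∈ seg (N + M), (L.map (fun p => f p v)).sum
      + 4 * hF0.toFinset.card := by omega
  have h4 : (4 * (N + M : ℕ) : ℝ) ≤ (∑ v ∈ seg (N + M), (L.map (fun p => f p v)).sum : ℕ)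
      + 4 * hF0.toFinset.card := by exact_mod_cast h3
  have h5 : (L.length : ℝ) ≤ 12 := by exact_mod_cast hL
  rw [div_lt_iff₀ (by linarith)] at hM
  have h6 : (L.length : ℝ) * (κ * (N + M : ℕ)) ≤ 12 * (κ * (N + M : ℕ)) :=
    mul_le_mul_of_nonneg_right h5 (by positivity)
  have h7 : (M : ℝ) ≤ (N + M : ℕ) := by push_cast; linarith [(Nat.cast_nonneg N : (0 : ℝ) ≤ N)]
  nlinarith

/-! ### The all-good case -/

theorem finite_cover (Zset : Set ℕ+) (Q : Set (Fin 4 × Set ℕ+))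
    (h : ∀ V W : NPU, Zset ∈ V.1 → Zset ∈ W.1 → ∃ q ∈ Q, q.2 ∈ V.1 ∧ q.2 ∈ W.1) :
    ∃ F : Finset (Fin 4 × Set ℕ+), (∀ q ∈ F, q ∈ Q) ∧
      ∀ V W : NPU, Zset ∈ V.1 → Zset ∈ W.1 → ∃ q ∈ F, q.2 ∈ V.1 ∧ q.2 ∈ W.1 := by
  classical
  let X : Set (Ultrafilter ℕ+) := {U | (U : Filter ℕ+) ≤ cofinite ∧ Zset ∈ U}
  have hX : IsClosed X := by
    have : X = (⋂ s : Finset ℕ+, {U : Ultrafilter ℕ+ | ((s : Set ℕ+)ᶜ) ∈ U}) ∩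
        {U : Ultrafilter ℕ+ | Zset ∈ U} := by
      ext U
      simp only [X, Set.mem_inter_iff, Set.mem_iInter, Set.mem_ofPred_eq]
      refine and_congr_left fun _ => ⟨fun hU s => hU s.finite_toSet.compl_mem_cofinite, ?_⟩
      intro hU s hs
      have hs' : sᶜ.Finite := hs
      have := hU hs'.toFinset
      simpa using this
    rw [this]
    exact (isClosed_iInter fun s => ultrafilter_isClosed_basic _).inter
      (ultrafilter_isClosed_basic _)
  have hc : IsCompact (X ×ˢ X) := hX.isCompact.prod hX.isCompact
  obtain ⟨t, ht⟩ := hc.elim_finite_subcover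
    (fun q : Q => {U : Ultrafilter ℕ+ | q.1.2 ∈ U} ×ˢ {U : Ultrafilter ℕ+ | q.1.2 ∈ U})
    (fun q => (ultrafilter_isOpen_basic _).prod (ultrafilter_isOpen_basic _)) (by
      rintro ⟨V, W⟩ ⟨hV, hW⟩
      obtain ⟨q, hq, h1, h2⟩ := h ⟨V, hV.1⟩ ⟨W, hW.1⟩ hV.2 hW.2
      exact Set.mem_iUnion.2 ⟨⟨q, hq⟩, h1, h2⟩)
  refine ⟨t.image (fun q => q.1), ?_, ?_⟩
  · intro q hq
    obtain ⟨q', -, rfl⟩ := Finset.mem_image.1 hq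
    exact q'.2
  · intro V W hV hW
    have := ht (show (V.1, W.1) ∈ X ×ˢ X from ⟨⟨V.2, hV⟩, ⟨W.2, hW⟩⟩)
    simp only [Set.mem_iUnion] at this
    obtain ⟨q, hq, h1, h2⟩ := this
    exact ⟨q.1, Finset.mem_image_of_mem _ hq, h1, h2⟩

theorem allgood_false {c : Sym2 ℕ+ → Fin 4} {κ : ℝ} (hκ0 : 0 < κ) (hκ : κ < 1 / 3)
    (h : SparseH c κ) (T : Finset (Fin 4)) (K : Fin 4 → Set ℕ+) (hT : T.card ≤ 2)
    (h1 : ∀ t ∈ T, ∀ V, (sysOf c).cls t V = none ∨ (sysOf c).cls t V = some (K t))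
    (h2 : ∀ V W, (∀ t ∈ T, (sysOf c).cls t V = none) → (∀ t ∈ T, (sysOf c).cls t W = none) →
      (sysOf c).Good V W) : False := by
  classical
  let Zset : Set ℕ+ := {v | ∀ t ∈ T, Maximal (Linked c t) (K t) → v ∉ K t}
  have hnone : ∀ V : NPU, Zset ∈ V.1 → ∀ t ∈ T, (sysOf c).cls t V = none := by
    intro V hV t ht
    rcases h1 t ht V with e | e
    · exact e
    · obtain ⟨hm, hK⟩ := clsU_iff.1 (show clsU c t V = some (K t) from e)
      obtain ⟨v, hv, hv'⟩ := (V.infinite (inter_mem hV hK)).nonempty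
      exact absurd hv' (hv t ht hm)
  obtain ⟨F, hF, hcov⟩ := finite_cover Zset {q | q.1 ∉ T ∧ Maximal (Linked c q.1) q.2} (by
    intro V W hV hW
    obtain ⟨t, q, e1, e2⟩ := h2 V W (hnone V hV) (hnone W hW)
    have e1' := clsU_iff.1 (show clsU c t V = some q from e1)
    have e2' := clsU_iff.1 (show clsU c t W = some q from e2)
    refine ⟨(t, q), ⟨fun ht => ?_, e1'.1⟩, e1'.2, e2'.2⟩
    rw [hnone V hV t ht] at e1
    exact absurd e1 (by simp))
  let τ : ℕ+ → Finset (Fin 4 × Set ℕ+) := fun z => F.filter (fun q => z ∈ q.2)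
  have hτ : ∀ z q, q ∈ τ z ↔ q ∈ F ∧ z ∈ q.2 := fun z q => by simp [τ]
  let fib : Finset (Fin 4 × Set ℕ+) → Set ℕ+ := fun S => {z | z ∈ Zset ∧ τ z = S}
  let F0 : Set ℕ+ := {z | z ∈ Zset ∧ (fib (τ z)).Finite}
  have hF0 : F0.Finite := by
    have : F0 ⊆ ⋃ S ∈ (F.powerset.filter (fun S => (fib S).Finite) : Finset _), fib S := by
      intro z hz
      simp only [Set.mem_iUnion]
      refine ⟨τ z, ?_, hz.1, rfl⟩
      rw [Finset.mem_filter]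
      exact ⟨Finset.mem_powerset.2 (Finset.filter_subset _ _), hz.2⟩
    refine Set.Finite.subset (Set.Finite.biUnion (Finset.finite_toSet _) ?_) this
    intro S hS
    exact (Finset.mem_filter.1 (Finset.mem_coe.1 hS)).2
  have hul : ∀ z ∈ Zset, z ∉ F0 → ∃ V : NPU, fib (τ z) ∈ V.1 := by
    intro z hz hzF
    exact exists_NPU (fun hf => hzF ⟨hz, hf⟩)
  have hfZ : ∀ S, fib S ⊆ Zset := fun S z hz => hz.1
  -- thresholds
  have hthr : ∀ L : Finset (Fin 4 × Set ℕ+), (∀ q ∈ L, Linked c q.1 q.2) → ∃ N : ℕ, ∀ n, N ≤ n →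
      ∀ q ∈ L, (((seg n).filter (fun a => a ∈ q.2)).card : ℝ) < κ * n := by
    intro L
    induction L using Finset.induction_on with
    | empty => intro _; exact ⟨0, by simp⟩
    | insert a s ha ih =>
      intro hl
      obtain ⟨N, hN⟩ := ih (fun q hq => hl q (Finset.mem_insert_of_mem hq))
      obtain ⟨N', hN'⟩ := h a.1 a.2 (hl a (Finset.mem_insert_self _ _))
      refine ⟨N + N', fun n hn q hq => ?_⟩
      rcases Finset.mem_insert.1 hq with rfl | hq
      · have := hN' n (by omega)
        convert this
      · exact hN n (by omega) q hq
  obtain ⟨N1, hN1⟩ := hthr F (fun q hq => (hF q hq).2.prop)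
  let T' := T.filter (fun t => Maximal (Linked c t) (K t))
  obtain ⟨N2, hN2⟩ := hthr (T'.image (fun t => (t, K t))) (by
    intro q hq
    obtain ⟨t, ht, rfl⟩ := Finset.mem_image.1 hq
    exact (Finset.mem_filter.1 ht).2.prop)
  obtain ⟨M, hM⟩ := exists_nat_gt ((hF0.toFinset.card : ℝ) / (1 - 3 * κ))
  let n := N1 + N2 + M + 1
  have hn1 := hN1 n (by omega)
  have hn2 := hN2 n (by omega)
  let Z : Finset ℕ+ := ((seg n).filter (fun a => a ∈ Zset)) \ hF0.toFinset
  have hZm : ∀ z ∈ Z, z ∈ Zset ∧ z ∉ F0 := by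
    intro z hz
    simp only [Z, Finset.mem_sdiff, Finset.mem_filter, Set.Finite.mem_toFinset] at hz
    exact ⟨hz.1.2, hz.2⟩
  have hκn : 0 ≤ κ * n := by positivity
  -- bound on Z
  have hZb : (Z.card : ℝ) ≤ (3 - T.card : ℕ) * (κ * n) := by
    rcases Z.eq_empty_or_nonempty with e | hne
    · rw [e, Finset.card_empty, Nat.cast_zero]; positivity
    obtain ⟨q, hq, hle⟩ := gyarfas Z F Tᶜ (3 - T.card) (by omega)
      (by rw [Finset.card_compl, Fintype.card_fin]; omega)
      (fun q hq => Finset.mem_compl.2 (hF q hq).1)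
      (by
        intro z hz q hq q' hq' hzq hzq' e
        obtain ⟨V, hV⟩ := hul z (hZm z hz).1 (hZm z hz).2
        have key : ∀ q ∈ F, z ∈ q.2 → q.2 ∈ V.1 := by
          intro q hq hzq
          refine mem_of_superset hV ?_
          intro y hy
          have : q ∈ τ y := by rw [hy.2]; exact (hτ _ _).2 ⟨hq, hzq⟩
          exact ((hτ _ _).1 this).2
        refine Prod.ext e ?_
        have hm := (hF q hq).2
        rw [e] at hm
        exact max_unique hm (hF q' hq').2 (key q hq hzq) (key q' hq' hzq'))
      (by
        intro z hz z' hz'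
        obtain ⟨V, hV⟩ := hul z (hZm z hz).1 (hZm z hz).2
        obtain ⟨W, hW⟩ := hul z' (hZm z' hz').1 (hZm z' hz').2
        obtain ⟨q, hq, e1, e2⟩ := hcov V W (mem_of_superset hV (hfZ _))
          (mem_of_superset hW (hfZ _))
        refine ⟨q, hq, ?_, ?_⟩
        · obtain ⟨y, hy, hyq⟩ := (V.infinite (inter_mem hV e1)).nonempty
          have : q ∈ τ z := by rw [← hy.2]; exact (hτ _ _).2 ⟨hq, hyq⟩
          exact ((hτ _ _).1 this).2
        · obtain ⟨y, hy, hyq⟩ := (W.infinite (inter_mem hW e2)).nonempty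
          have : q ∈ τ z' := by rw [← hy.2]; exact (hτ _ _).2 ⟨hq, hyq⟩
          exact ((hτ _ _).1 this).2) hne
    have hsub : (Z.filter (fun z => z ∈ q.2)).card ≤ ((seg n).filter (fun a => a ∈ q.2)).card := by
      refine Finset.card_le_card ?_
      intro z hz
      simp only [Z, Finset.mem_filter, Finset.mem_sdiff] at hz ⊢
      exact ⟨hz.1.1.1, hz.2⟩
    have hle' : (Z.card : ℝ) ≤ ((3 - T.card : ℕ) : ℝ) * ((Z.filter (fun z => z ∈ q.2)).card : ℝ) := by
      exact_mod_cast hle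
    refine hle'.trans (mul_le_mul_of_nonneg_left ?_ (by positivity))
    have hsub' : ((Z.filter (fun z => z ∈ q.2)).card : ℝ) ≤
      ((seg n).filter (fun a => a ∈ q.2)).card := by exact_mod_cast hsub
    exact hsub'.trans (hn1 q hq).le
  have hsum : n ≤ Z.card + hF0.toFinset.card +
      ∑ t ∈ T', ((seg n).filter (fun a => a ∈ K t)).card := by
    have hs : seg n ⊆ (Z ∪ hF0.toFinset) ∪ T'.biUnion (fun t => (seg n).filter (fun a => a ∈ K t)) := by
      intro v hv
      by_cases hvZ : v ∈ Zset
      · apply Finset.mem_union_left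
        by_cases hv0 : v ∈ F0
        · exact Finset.mem_union_right _ (by simpa using hv0)
        · apply Finset.mem_union_left
          simp only [Z, Finset.mem_sdiff, Finset.mem_filter, Set.Finite.mem_toFinset]
          exact ⟨⟨hv, hvZ⟩, hv0⟩
      · apply Finset.mem_union_right
        have : ∃ t ∈ T, Maximal (Linked c t) (K t) ∧ v ∈ K t := by
          by_contra hx
          push Not at hx
          exact hvZ hx
        obtain ⟨t, ht, hm, hvt⟩ := this
        exact Finset.mem_biUnion.2 ⟨t, Finset.mem_filter.2 ⟨ht, hm⟩, Finset.mem_filter.2 ⟨hv, hvt⟩⟩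
    calc n = (seg n).card := (card_seg n).symm
      _ ≤ _ := Finset.card_le_card hs
      _ ≤ _ := Finset.card_union_le _ _
      _ ≤ _ := Nat.add_le_add (Finset.card_union_le _ _) Finset.card_biUnion_le
  have hsumR : (n : ℝ) ≤ Z.card + hF0.toFinset.card +
      ∑ t ∈ T', (((seg n).filter (fun a => a ∈ K t)).card : ℝ) := by exact_mod_cast hsum
  have hTb : ∑ t ∈ T', (((seg n).filter (fun a => a ∈ K t)).card : ℝ) ≤ T.card * (κ * n) := by
    calc _ ≤ ∑ t ∈ T', κ * n := Finset.sum_le_sum fun t ht =>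
          (hn2 (t, K t) (Finset.mem_image_of_mem _ ht)).le
      _ = T'.card * (κ * n) := by rw [Finset.sum_const, nsmul_eq_mul]
      _ ≤ _ := mul_le_mul_of_nonneg_right (by exact_mod_cast Finset.card_filter_le _ _) hκn
  have h3 : ((3 - T.card : ℕ) : ℝ) = 3 - T.card := by
    rw [Nat.cast_sub (by omega)]; norm_num
  rw [h3] at hZb
  rw [div_lt_iff₀ (by linarith)] at hM
  have hMn : (M : ℝ) ≤ n := by exact_mod_cast (show M ≤ n by omega)
  nlinarith

/-! ### Dominating sets in the four-constant case -/

theorem dominate {c : Sym2 ℕ+ → Fin 4} {t : Fin 4} {U : NPU} (hU : ∀ W, LL c t W ∈ U.1)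
    (W0 : NPU) (N : ℕ) : ∃ (F : Finset ℕ+) (N1 : ℕ), N ≤ N1 ∧
      (∀ f ∈ F, f ∈ LL c t W0 ∧ N < (f : ℕ) ∧ (f : ℕ) ≤ N1) ∧
      ∀ w : ℕ+, N1 < (w : ℕ) → ∃ f ∈ F, c s(f, w) = t := by
  classical
  by_contra hcon
  push Not at hcon
  let D : Set ℕ+ := LL c t W0 ∩ {x : ℕ+ | N < (x : ℕ)}
  have hD : D ∈ U.1 := by
    refine inter_mem (hU W0) (U.2 ?_)
    rw [mem_cofinite]
    refine (finite_le Set.univ N).subset ?_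
    intro x hx
    exact ⟨trivial, not_lt.1 hx⟩
  have hw : ∀ k : ℕ, ∃ w : ℕ+, k < (w : ℕ) ∧ ∀ f ∈ D, (f : ℕ) ≤ k → c s(f, w) ≠ t := by
    intro k
    obtain ⟨w, hw, hw'⟩ := hcon ((seg k).filter (fun x => x ∈ D)) (N + k) (by omega) (by
      intro f hf
      rw [Finset.mem_filter, mem_seg] at hf
      exact ⟨hf.2.1, hf.2.2, by omega⟩)
    exact ⟨w, by omega, fun f hf hk => hw' f (Finset.mem_filter.2 ⟨mem_seg.2 hk, hf⟩)⟩
  choose w hwk hwD using hw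
  have hle : (map w atTop) ≤ cofinite := by
    intro s hs
    have hs' : sᶜ.Finite := hs
    obtain ⟨m, hm⟩ := (hs'.image (fun x : ℕ+ => (x : ℕ))).bddAbove
    rw [mem_map]
    filter_upwards [eventually_ge_atTop m] with k hk
    by_contra hx
    have := hm ⟨w k, hx, rfl⟩
    have := hwk k
    simp only at *
    omega
  let W : NPU := ⟨Ultrafilter.of (map w atTop), (Ultrafilter.of_le _).trans hle⟩
  obtain ⟨f, hf, hfD⟩ := (U.infinite (inter_mem (hU W) hD)).nonempty
  have hev : ∀ᶠ x in (W.1 : Filter ℕ+), c s(f, x) ≠ t := by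
    refine (Ultrafilter.of_le (map w atTop)) ?_
    show {x | c s(f, x) ≠ t} ∈ map w atTop
    rw [mem_map]
    filter_upwards [eventually_ge_atTop (f : ℕ)] with k hk
    exact hwD k f hfD hk
  obtain ⟨x, hx, hx'⟩ := (Filter.Eventually.and hf hev).exists
  exact hx' hx

theorem attach_blocks {c : Sym2 ℕ+ → Fin 4} {t : Fin 4} {U : NPU} (hU : ∀ W, LL c t W ∈ U.1)
    (W0 : NPU) (m : ℕ) : ∀ N : ℕ, ∃ N' : ℕ, N ≤ N' ∧ ∀ PP : List (List ℕ+), PP.length ≤ m →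
      (∀ p ∈ PP, p ≠ [] ∧ p.IsChain (cadj c t)) → (∀ p ∈ PP, ∀ x ∈ p, N' < (x : ℕ)) →
      PP.flatten.Nodup → ∃ B : List (List ℕ+), (∀ b ∈ B, IsBlock c t (LL c t W0) b) ∧
        B.flatten.Nodup ∧ (∀ x ∈ B.flatten, N < (x : ℕ)) ∧ (∀ x ∈ PP.flatten, x ∈ B.flatten) ∧
        (∀ x ∈ B.flatten, x ∈ PP.flatten ∨ (x : ℕ) ≤ N') := by
  induction m with
  | zero =>
    intro N
    refine ⟨N, le_rfl, fun PP h _ _ _ => ⟨[], ?_⟩⟩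
    have : PP = [] := List.length_eq_zero_iff.1 (by omega)
    subst this
    simp
  | succ m ih =>
    intro N
    obtain ⟨F1, N1, hN1, hF1, hd1⟩ := dominate hU W0 N
    obtain ⟨F2, N2, hN2, hF2, hd2⟩ := dominate hU W0 N1
    obtain ⟨N', hN', H⟩ := ih N2
    refine ⟨N', by omega, fun PP hlen hch hgt hnd => ?_⟩
    cases PP with
    | nil => exact ⟨[], by simp⟩
    | cons p PP =>
      rw [List.flatten_cons, List.nodup_append] at hnd
      obtain ⟨hpn, hPn, hdis⟩ := hnd
      obtain ⟨B, hB, hBn, hBgt, hPB, hBP⟩ := H PP (by simpa using hlen)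
        (fun q hq => hch q (List.mem_cons_of_mem _ hq))
        (fun q hq => hgt q (List.mem_cons_of_mem _ hq)) hPn
      obtain ⟨hpne, hpch⟩ := hch p List.mem_cons_self
      have hpgt := hgt p List.mem_cons_self
      obtain ⟨f1, hf1, he1⟩ := hd1 (p.head hpne) (by
        have := hpgt _ (List.head_mem hpne); omega)
      obtain ⟨f2, hf2, he2⟩ := hd2 (p.getLast hpne) (by
        have := hpgt _ (List.getLast_mem hpne); omega)
      obtain ⟨hv1, hg1, hl1⟩ := hF1 f1 hf1
      obtain ⟨hv2, hg2, hl2⟩ := hF2 f2 hf2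
      have ne1 : ∀ x ∈ p, f1 ≠ x := by
        intro x hx e; have := hpgt x hx; rw [← e] at this; omega
      have ne2 : ∀ x ∈ p, f2 ≠ x := by
        intro x hx e; have := hpgt x hx; rw [← e] at this; omega
      refine ⟨(f1 :: (p ++ [f2])) :: B, ?_, ?_, ?_, ?_, ?_⟩
      · intro b hb
        rcases List.mem_cons.1 hb with rfl | hb
        · refine ⟨?_, ⟨f1, hv1, rfl⟩, ⟨f2, hv2, ?_⟩⟩
          · rw [List.isChain_cons]
            refine ⟨?_, ?_⟩
            · intro y hy
              rw [List.head?_append_of_ne_nil _ hpne, List.head?_eq_some_head hpne,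
                Option.mem_some_iff] at hy
              subst hy
              exact ⟨ne1 _ (List.head_mem hpne), he1⟩
            · rw [List.isChain_append]
              refine ⟨hpch, by simp, ?_⟩
              intro x hx y hy
              rw [List.getLast?_eq_some_getLast hpne, Option.mem_some_iff] at hx
              simp only [List.head?_cons, Option.mem_some_iff] at hy
              subst hx hy
              refine ⟨(ne2 _ (List.getLast_mem hpne)).symm, ?_⟩
              rw [Sym2.eq_swap]; exact he2
          · rw [← List.cons_append, List.getLast?_append]; simp
        · exact hB b hb
      · rw [List.flatten_cons, List.nodup_append]
        refine ⟨?_, hBn, ?_⟩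
        · rw [List.nodup_cons, List.nodup_append]
          refine ⟨?_, hpn, by simp, ?_⟩
          · rw [List.mem_append, List.mem_singleton]
            rintro (h | h)
            · exact ne1 _ h rfl
            · rw [h] at hl1; omega
          · intro a ha b hb
            rw [List.mem_singleton] at hb
            subst hb
            exact (ne2 a ha).symm
        · intro a ha b hb e
          subst e
          have h3 := hBgt a hb
          have h4 := hBP a hb
          rw [List.mem_cons, List.mem_append, List.mem_singleton] at ha
          rcases ha with rfl | ha | rfl
          · omega
          · have := hpgt a ha
            rcases h4 with h4 | h4
            · exact hdis a ha a h4 rfl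
            · omega
          · omega
      · intro x hx
        rw [List.flatten_cons, List.mem_append, List.mem_cons, List.mem_append,
          List.mem_singleton] at hx
        rcases hx with (rfl | hx | rfl) | hx
        · exact hg1
        · have := hpgt x hx; omega
        · omega
        · have := hBgt x hx; omega
      · intro x hx
        rw [List.flatten_cons, List.mem_append] at hx
        rw [List.flatten_cons, List.mem_append, List.mem_cons, List.mem_append]
        rcases hx with hx | hx
        · exact Or.inl (Or.inr (Or.inl hx))
        · exact Or.inr (hPB x hx)
      · intro x hx
        rw [List.flatten_cons, List.mem_append, List.mem_cons, List.mem_append,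
          List.mem_singleton] at hx
        rw [List.flatten_cons, List.mem_append]
        rcases hx with (rfl | hx | rfl) | hx
        · right; omega
        · exact Or.inl (Or.inl hx)
        · right; omega
        · rcases hBP x hx with h | h
          · exact Or.inl (Or.inr h)
          · exact Or.inr h

/-! ### Long monochromatic paths in bipartite graphs -/

open Classical in
theorem long_path_minDeg (R : ℕ+ → ℕ+ → Prop) (hs : ∀ x y, R x y → R y x) (V : Finset ℕ+) (d : ℕ)
    (hne : V.Nonempty) (h : ∀ v ∈ V, d < (V.filter (fun w => R v w)).card) :
    ∀ k ≤ d, ∃ p : List ℕ+, p.length = k + 1 ∧ p.Nodup ∧ p.IsChain R ∧ ∀ x ∈ p, x ∈ V := by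
  intro k
  induction k with
  | zero =>
    intro _
    obtain ⟨v, hv⟩ := hne
    exact ⟨[v], by simp [hv]⟩
  | succ k ih =>
    intro hk
    obtain ⟨p, hl, hn, hc, hV⟩ := ih (by omega)
    cases p with
    | nil => simp at hl
    | cons x q =>
      have hx := h x (hV x List.mem_cons_self)
      have hcard : (x :: q).toFinset.card ≤ k + 1 := hl ▸ List.toFinset_card_le _
      obtain ⟨y, hy, hy'⟩ := Finset.exists_mem_notMem_of_card_lt_card
        (show (x :: q).toFinset.card < (V.filter (fun w => R x w)).card by omega)
      rw [Finset.mem_filter] at hy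
      rw [List.mem_toFinset] at hy'
      refine ⟨y :: x :: q, by simp at hl ⊢; omega, List.nodup_cons.2 ⟨hy', hn⟩, ?_, ?_⟩
      · exact List.isChain_cons_cons.2 ⟨hs _ _ hy.2, hc⟩
      · intro z hz
        rcases List.mem_cons.1 hz with rfl | hz
        · exact hy.1
        · exact hV z hz

open Classical in
theorem long_path (R : ℕ+ → ℕ+ → Prop) (hs : ∀ x y, R x y → R y x) (d : ℕ) : ∀ (k : ℕ)
    (V : Finset ℕ+), V.card = k →
    2 * d * V.card < ∑ v ∈ V, (V.filter (fun w => R v w)).card →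
    ∃ p : List ℕ+, p.length = d + 1 ∧ p.Nodup ∧ p.IsChain R ∧ ∀ x ∈ p, x ∈ V := by
  intro k
  induction k with
  | zero =>
    intro V hV h
    rw [Finset.card_eq_zero] at hV
    subst hV
    simp at h
  | succ k ih =>
    intro V hV h
    by_cases hm : ∀ v ∈ V, d < (V.filter (fun w => R v w)).card
    · exact long_path_minDeg R hs V d (Finset.card_pos.1 (by omega)) hm d le_rfl
    · push Not at hm
      obtain ⟨v, hv, hd⟩ := hm
      have hcard : (V.erase v).card = k := by rw [Finset.card_erase_of_mem hv]; omega
      obtain ⟨p, h1, h2, h3, h4⟩ := ih (V.erase v) hcard (by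
        have e1 : ∑ u ∈ V, (V.filter (fun w => R u w)).card =
            (V.filter (fun w => R v w)).card + ∑ u ∈ V.erase v, (V.filter (fun w => R u w)).card :=
          (Finset.add_sum_erase _ _ hv).symm
        have e2 : ∑ u ∈ V.erase v, (V.filter (fun w => R u w)).card ≤
            ∑ u ∈ V.erase v, (((V.erase v).filter (fun w => R u w)).card +
              if R u v then 1 else 0) := by
          refine Finset.sum_le_sum fun u _ => ?_
          have : V.filter (fun w => R u w) ⊆
              ((V.erase v).filter (fun w => R u w)) ∪ (if R u v then {v} else ∅) := by
            intro w hw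
            rw [Finset.mem_filter] at hw
            rw [Finset.mem_union, Finset.mem_filter, Finset.mem_erase]
            by_cases e : w = v
            · right; subst e; rw [if_pos hw.2]; exact Finset.mem_singleton_self _
            · exact Or.inl ⟨⟨e, hw.1⟩, hw.2⟩
          refine (Finset.card_le_card this).trans ((Finset.card_union_le _ _).trans ?_)
          split_ifs <;> simp
        rw [Finset.sum_add_distrib, ← Finset.card_filter] at e2
        have e3 : ((V.erase v).filter (fun u => R u v)).card ≤
            (V.filter (fun w => R v w)).card := by
          refine Finset.card_le_card ?_
          intro w hw
          rw [Finset.mem_filter] at hw ⊢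
          exact ⟨Finset.mem_of_mem_erase hw.1, hs _ _ hw.2⟩
        rw [hcard]
        rw [hV] at h
        have e4 : 2 * d * (k + 1) = 2 * d * k + 2 * d := by ring
        omega)
      exact ⟨p, h1, h2, h3, fun x hx => Finset.mem_of_mem_erase (h4 x hx)⟩

open Classical in
theorem alt_count (A : Set ℕ+) : ∀ (l : ℕ) (p : List ℕ+), p.length = 2 * l →
    p.IsChain (fun x y => (x ∈ A ↔ y ∉ A)) → (p.filter (fun x => x ∈ A)).length = l := by
  intro l
  induction l with
  | zero =>
    intro p hp _
    have : p = [] := List.length_eq_zero_iff.1 (by omega)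
    subst this; simp
  | succ l ih =>
    intro p hp hc
    match p, hp, hc with
    | [], hp, _ => simp at hp
    | [x], hp, _ => simp at hp; omega
    | x :: y :: q, hp, hc =>
      rw [List.isChain_cons_cons] at hc
      have h2 := ih q (by simp at hp; omega) hc.2.tail
      by_cases hx : x ∈ A
      · have hy : y ∉ A := hc.1.1 hx
        simp [hx, hy, h2]
      · have hy : y ∈ A := by
          by_contra hy; exact hx (hc.1.2 hy)
        simp [hx, hy, h2]

open Classical in
theorem bip_path (c : Sym2 ℕ+ → Fin 4) (A B : Finset ℕ+) (hd : Disjoint A B) (l : ℕ) (hl : 1 ≤ l)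
    (hA : 16 * l ≤ A.card) (hB : 16 * l ≤ B.card) :
    ∃ (t : Fin 4) (p : List ℕ+), p.length = 2 * l ∧ p.Nodup ∧ p.IsChain (cadj c t) ∧
      (∀ x ∈ p, x ∈ A ∪ B) ∧ (p.filter (fun x => x ∈ A)).length = l ∧
      (p.filter (fun x => x ∈ B)).length = l := by
  let R : Fin 4 → ℕ+ → ℕ+ → Prop := fun t x y =>
    ((x ∈ A ∧ y ∈ B) ∨ (x ∈ B ∧ y ∈ A)) ∧ c s(x, y) = t
  have hs : ∀ t x y, R t x y → R t y x := by
    rintro t x y ⟨h1, h2⟩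
    refine ⟨by tauto, ?_⟩
    rw [Sym2.eq_swap]; exact h2
  have hnot : ∀ x, x ∈ A → x ∉ B := fun x h h' => Finset.disjoint_left.1 hd h h'
  have htot : ∑ t, ∑ v ∈ A ∪ B, ((A ∪ B).filter (fun w => R t v w)).card = 2 * A.card * B.card := by
    rw [Finset.sum_comm]
    have : ∀ v ∈ A ∪ B, ∑ t, ((A ∪ B).filter (fun w => R t v w)).card =
        if v ∈ A then B.card else A.card := by
      intro v hv
      have e : ∀ t, (A ∪ B).filter (fun w => R t v w) =
          (if v ∈ A then B else A).filter (fun w => c s(v, w) = t) := by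
        intro t
        ext w
        simp only [R, Finset.mem_filter, Finset.mem_union] at hv ⊢
        have h1 := hnot v
        have h2 := hnot w
        split_ifs <;> tauto
      simp only [e]
      rw [← Finset.card_eq_sum_card_fiberwise (fun x _ => Finset.mem_univ _)]
      split_ifs <;> rfl
    rw [Finset.sum_congr rfl this, Finset.sum_union hd]
    have e1 : ∑ v ∈ A, (if v ∈ A then B.card else A.card) = A.card * B.card := by
      rw [Finset.sum_congr rfl (fun v hv => if_pos hv), Finset.sum_const, smul_eq_mul]
    have e2 : ∑ v ∈ B, (if v ∈ A then B.card else A.card) = B.card * A.card := by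
      rw [Finset.sum_congr rfl (fun v hv => if_neg (fun h => hnot v h hv)), Finset.sum_const,
        smul_eq_mul]
    rw [e1, e2]; ring
  have hex : ∃ t, 2 * (2 * l - 1) * (A ∪ B).card <
      ∑ v ∈ A ∪ B, ((A ∪ B).filter (fun w => R t v w)).card := by
    by_contra hx
    push Not at hx
    have := Finset.sum_le_sum (fun t (_ : t ∈ Finset.univ) => hx t)
    rw [htot, Finset.sum_const, Finset.card_univ, Fintype.card_fin, smul_eq_mul,
      Finset.card_union_of_disjoint hd] at this
    obtain ⟨l', rfl⟩ : ∃ l', l = l' + 1 := ⟨l - 1, by omega⟩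
    have e : 2 * (l' + 1) - 1 = 2 * l' + 1 := by omega
    rw [e] at this
    nlinarith
  obtain ⟨t, ht⟩ := hex
  obtain ⟨p, h1, h2, h3, h4⟩ := long_path (R t) (hs t) (2 * l - 1) _ (A ∪ B) rfl
    (by convert ht)
  have hlen : p.length = 2 * l := by omega
  refine ⟨t, p, hlen, h2, ?_, h4, ?_, ?_⟩
  · refine h3.imp ?_
    rintro x y ⟨h, h'⟩
    refine ⟨?_, h'⟩
    rintro rfl
    rcases h with h | h
    · exact hnot x h.1 h.2
    · exact hnot x h.2 h.1
  · have := alt_count (A : Set ℕ+) l p hlen (h3.imp (by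
      rintro x y ⟨h, h'⟩
      have h1 := hnot x
      have h2 := hnot y
      simp only [Finset.mem_coe]
      tauto))
    simpa using this
  · have := alt_count (B : Set ℕ+) l p hlen (h3.imp (by
      rintro x y ⟨h, h'⟩
      have h1 := hnot x
      have h2 := hnot y
      simp only [Finset.mem_coe]
      tauto))
    simpa using this

/-! ### The finite greedy lemma -/

/-- vertices on a family of paths -/
def vx (P : List (List ℕ+)) : Finset ℕ+ := P.flatten.toFinset

/-- vertices of other classes -/
def gg (col : ℕ+ → Fin 4) (t : Fin 4) (P : List (List ℕ+)) : ℕ :=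
  ((vx P).filter (fun x => col x ≠ t)).card

/-- vertices of own class -/
def vv (col : ℕ+ → Fin 4) (t : Fin 4) (P : List (List ℕ+)) : ℕ :=
  ((vx P).filter (fun x => col x = t)).card

/-- the set covered for colour `t` -/
def CC (S : Finset ℕ+) (col : ℕ+ → Fin 4) (t : Fin 4) (P : List (List ℕ+)) : Finset ℕ+ :=
  S.filter (fun x => col x = t) ∪ vx P

/-- families of disjoint paths -/
def Fam (c : Sym2 ℕ+ → Fin 4) (S : Finset ℕ+) (k : ℕ) (t : Fin 4)
    (P : List (List ℕ+)) : Prop :=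
  P.length ≤ k ∧ (∀ p ∈ P, p ≠ [] ∧ p.IsChain (cadj c t)) ∧ P.flatten.Nodup ∧
    (∀ x ∈ P.flatten, x ∈ S)

theorem vx_cons (p : List ℕ+) (P : List (List ℕ+)) : vx (p :: P) = p.toFinset ∪ vx P := by
  simp [vx]

theorem card_CC {c : Sym2 ℕ+ → Fin 4} {S : Finset ℕ+} {k : ℕ} {t : Fin 4} {P : List (List ℕ+)}
    (col : ℕ+ → Fin 4) (h : Fam c S k t P) :
    (CC S col t P).card = (S.filter (fun x => col x = t)).card + gg col t P := by
  have : CC S col t P = S.filter (fun x => col x = t) ∪ (vx P).filter (fun x => col x ≠ t) := by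
    ext x
    simp only [CC, Finset.mem_union, Finset.mem_filter]
    have h4 : x ∈ vx P → x ∈ S := fun hx => h.2.2.2 x (by simpa [vx] using hx)
    tauto
  rw [this, Finset.card_union_of_disjoint, gg]
  rw [Finset.disjoint_left]
  intro x hx hx'
  exact (Finset.mem_filter.1 hx').2 (Finset.mem_filter.1 hx).2

theorem two_big (a : Fin 4 → ℕ) (m : ℕ) (κs : ℝ) (h1 : ∀ i, (a i : ℝ) < κs)
    (h2 : κs + 3 * m ≤ ∑ i, (a i : ℝ)) : ∃ i j, i ≠ j ∧ m ≤ a i ∧ m ≤ a j := by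
  by_contra hcon
  push Not at hcon
  obtain ⟨i, -, hi⟩ := Finset.exists_max_image Finset.univ a Finset.univ_nonempty
  have h3 : ∀ j, j ≠ i → (a j : ℝ) ≤ m := by
    intro j hj
    by_contra hx
    push Not at hx
    have hx' : m < a j := by exact_mod_cast hx
    have h4 := hi j (Finset.mem_univ _)
    have := hcon j i hj hx'.le
    omega
  rw [← Finset.add_sum_erase _ _ (Finset.mem_univ i)] at h2
  have h5 : ∑ j ∈ Finset.univ.erase i, (a j : ℝ) ≤ ∑ j ∈ Finset.univ.erase i, (m : ℝ) :=
    Finset.sum_le_sum fun j hj => h3 j (Finset.ne_of_mem_erase hj)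
  rw [Finset.sum_const, Finset.card_erase_of_mem (Finset.mem_univ _), Finset.card_univ,
    Fintype.card_fin, nsmul_eq_mul] at h5
  have := h1 i
  have e3 : ((4 - 1 : ℕ) : ℝ) = 3 := by norm_num
  rw [e3] at h5
  linarith

theorem greedy_step {c : Sym2 ℕ+ → Fin 4} {S : Finset ℕ+} {κ : ℝ} {k l : ℕ}
    (col : ℕ+ → Fin 4) (P : Fin 4 → List (List ℕ+))
    (hP : ∀ t, Fam c S k t (P t)) (hv : ∀ t, vv col t (P t) ≤ gg col t (P t))
    (hl : 1 ≤ l) (hl' : (48 * l : ℝ) ≤ (3 - 9 * κ) * S.card)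
    (hC : ∀ t, ((CC S col t (P t)).card : ℝ) < κ * S.card) :
    ∃ P' : Fin 4 → List (List ℕ+), (∀ t, Fam c S (k + 1) t (P' t)) ∧
      (∀ t, vv col t (P' t) ≤ gg col t (P' t)) ∧
      ∑ t, gg col t (P t) + l ≤ ∑ t, gg col t (P' t) := by
  classical
  let R : Finset ℕ+ := S \ Finset.univ.biUnion (fun t => vx (P t))
  have hRS : ∀ x ∈ R, x ∈ S ∧ ∀ t, x ∉ vx (P t) := by
    intro x hx
    simp only [R, Finset.mem_sdiff, Finset.mem_biUnion, Finset.mem_univ, true_and, not_exists] at hx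
    exact hx
  have hvx : ∀ t, (vx (P t)).card = vv col t (P t) + gg col t (P t) := fun t =>
    (Finset.card_filter_add_card_filter_not (s := vx (P t)) (fun x => col x = t)).symm
  have hR : S.card ≤ R.card + 2 * ∑ t, gg col t (P t) := by
    have h1 : (Finset.univ.biUnion (fun t => vx (P t))).card ≤ 2 * ∑ t, gg col t (P t) := by
      refine Finset.card_biUnion_le.trans ?_
      rw [Finset.mul_sum]
      refine Finset.sum_le_sum fun t _ => ?_
      rw [hvx]
      have := hv t
      omega
    have h2 := Finset.le_card_sdiff (Finset.univ.biUnion (fun t => vx (P t))) S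
    show _ ≤ (S \ _).card + _
    omega
  have hsumC : (S.card : ℝ) + (∑ t, gg col t (P t) : ℕ) ≤ 4 * (κ * S.card) := by
    have h1 : ∑ t, (CC S col t (P t)).card = S.card + ∑ t, gg col t (P t) := by
      rw [Finset.sum_congr rfl (fun t _ => card_CC col (hP t)), Finset.sum_add_distrib,
        ← Finset.card_eq_sum_card_fiberwise (fun x _ => Finset.mem_univ _)]
    have h2 : (∑ t, ((CC S col t (P t)).card : ℝ)) ≤ ∑ _t : Fin 4, κ * S.card :=
      Finset.sum_le_sum fun t _ => (hC t).le
    have h3 : ((∑ t, (CC S col t (P t)).card : ℕ) : ℝ) ≤ ∑ _t : Fin 4, κ * S.card := by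
      rw [Nat.cast_sum]; exact h2
    rw [h1, Finset.sum_const, Finset.card_univ, Fintype.card_fin, nsmul_eq_mul, Nat.cast_add] at h3
    exact_mod_cast h3
  have hRsum : ∑ i, (((R.filter (fun x => col x = i)).card : ℕ) : ℝ) = R.card := by
    rw [← Nat.cast_sum, ← Finset.card_eq_sum_card_fiberwise (fun x _ => Finset.mem_univ _)]
  have hR' : (S.card : ℝ) ≤ R.card + 2 * (∑ t, gg col t (P t) : ℕ) := by exact_mod_cast hR
  obtain ⟨i, j, hij, hi, hj⟩ := two_big (fun i => (R.filter (fun x => col x = i)).card) (16 * l)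
    (κ * S.card) (by
      intro i
      refine lt_of_le_of_lt ?_ (hC i)
      have : (R.filter (fun x => col x = i)).card ≤ (CC S col i (P i)).card := by
        refine Finset.card_le_card ?_
        intro x hx
        rw [Finset.mem_filter] at hx
        exact Finset.mem_union_left _ (Finset.mem_filter.2 ⟨(hRS x hx.1).1, hx.2⟩)
      exact_mod_cast this) (by
      rw [hRsum]; push_cast; push_cast at hsumC hR'; linarith)
  have hdis : Disjoint (R.filter (fun x => col x = i)) (R.filter (fun x => col x = j)) := by
    rw [Finset.disjoint_left]
    intro x hx hx'
    exact hij ((Finset.mem_filter.1 hx).2.symm.trans (Finset.mem_filter.1 hx').2)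
  obtain ⟨t, p, h1, h2, h3, h4, h5, h6⟩ := bip_path c _ _ hdis l hl hi hj
  have hpR : ∀ x ∈ p, x ∈ R ∧ (col x = i ∨ col x = j) := by
    intro x hx
    have := h4 x hx
    simp only [Finset.mem_union, Finset.mem_filter] at this
    tauto
  have hcount : ∀ s, (p.toFinset.filter (fun x => col x = s)).card ≤ l := by
    intro s
    have key : ∀ r, (p.filter (fun x => x ∈ R.filter (fun x => col x = r))).length = l →
        (p.toFinset.filter (fun x => col x = r)).card ≤ l := by
      intro r hr
      rw [← hr]
      refine le_trans (Finset.card_le_card ?_) (List.toFinset_card_le _)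
      intro x hx
      rw [Finset.mem_filter, List.mem_toFinset] at hx
      rw [List.mem_toFinset, List.mem_filter]
      exact ⟨hx.1, by simp [(hpR x hx.1).1, hx.2]⟩
    by_cases e1 : s = i
    · subst e1; exact key _ (by convert h5)
    by_cases e2 : s = j
    · subst e2; exact key _ (by convert h6)
    have : p.toFinset.filter (fun x => col x = s) = ∅ := by
      rw [Finset.filter_eq_empty_iff]
      intro x hx hxs
      rw [List.mem_toFinset] at hx
      rcases (hpR x hx).2 with e | e
      · exact e1 (hxs.symm.trans e)
      · exact e2 (hxs.symm.trans e)
    rw [this]; simp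
  have hpcard : p.toFinset.card = 2 * l := by rw [List.toFinset_card_of_nodup h2, h1]
  have hcount' : l ≤ (p.toFinset.filter (fun x => col x ≠ t)).card := by
    have e1 := Finset.card_filter_add_card_filter_not (s := p.toFinset) (fun x => col x = t)
    have e2 := hcount t
    have e3 : l + (p.toFinset.filter (fun x => ¬ col x = t)).card ≥ 2 * l := by omega
    show l ≤ (p.toFinset.filter (fun x => ¬ col x = t)).card
    omega
  have hpd : ∀ s, Disjoint p.toFinset (vx (P s)) := by
    intro s
    rw [Finset.disjoint_left]
    intro x hx
    exact (hRS x (hpR x (by simpa using hx)).1).2 s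
  have hgcons : gg col t (p :: P t) =
      (p.toFinset.filter (fun x => col x ≠ t)).card + gg col t (P t) := by
    rw [gg, vx_cons, Finset.filter_union, Finset.card_union_of_disjoint
      (Finset.disjoint_filter_filter (hpd t)), gg]
  have hvcons : vv col t (p :: P t) =
      (p.toFinset.filter (fun x => col x = t)).card + vv col t (P t) := by
    rw [vv, vx_cons, Finset.filter_union, Finset.card_union_of_disjoint
      (Finset.disjoint_filter_filter (hpd t)), vv]
  refine ⟨Function.update P t (p :: P t), ?_, ?_, ?_⟩
  · intro s
    by_cases e : s = t
    · subst e
      rw [Function.update_self]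
      obtain ⟨q1, q2, q3, q4⟩ := hP s
      refine ⟨by simp; omega, ?_, ?_, ?_⟩
      · intro q hq
        rcases List.mem_cons.1 hq with rfl | hq
        · refine ⟨?_, h3⟩
          rintro rfl
          simp at h1
          omega
        · exact q2 q hq
      · rw [List.flatten_cons, List.nodup_append]
        refine ⟨h2, q3, ?_⟩
        rintro a ha b hb rfl
        exact (hRS a (hpR a ha).1).2 s (by simpa [vx] using hb)
      · intro x hx
        rw [List.flatten_cons, List.mem_append] at hx
        rcases hx with hx | hx
        · exact (hRS x (hpR x hx).1).1
        · exact q4 x hx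
    · rw [Function.update_of_ne e]
      obtain ⟨q1, q2⟩ := hP s
      exact ⟨by omega, q2⟩
  · intro s
    by_cases e : s = t
    · subst e
      rw [Function.update_self, hgcons, hvcons]
      have := hcount s
      have := hv s
      omega
    · rw [Function.update_of_ne e]; exact hv s
  · have : ∀ s ∈ Finset.univ, gg col s (P s) + (if s = t then l else 0) ≤
        gg col s (Function.update P t (p :: P t) s) := by
      intro s _
      by_cases e : s = t
      · subst e
        rw [Function.update_self, hgcons, if_pos rfl]
        omega
      · rw [Function.update_of_ne e, if_neg e]; omega
    have := Finset.sum_le_sum this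
    rw [Finset.sum_add_distrib, Finset.sum_ite_eq' Finset.univ t (fun _ => l),
      if_pos (Finset.mem_univ t)] at this
    exact this

theorem greedy {c : Sym2 ℕ+ → Fin 4} {S : Finset ℕ+} {κ : ℝ} {l : ℕ}
    (col : ℕ+ → Fin 4) (hl : 1 ≤ l) (hl' : (48 * l : ℝ) ≤ (3 - 9 * κ) * S.card) (k : ℕ) :
    (∃ t P, Fam c S k t P ∧ κ * S.card ≤ ((CC S col t P).card : ℝ)) ∨
    ∃ P : Fin 4 → List (List ℕ+), (∀ t, Fam c S k t (P t)) ∧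
      (∀ t, vv col t (P t) ≤ gg col t (P t)) ∧ k * l ≤ ∑ t, gg col t (P t) := by
  induction k with
  | zero =>
    right
    exact ⟨fun _ => [], fun t => ⟨by simp, by simp, by simp, by simp⟩,
      fun t => by simp [vv, gg, vx], by simp⟩
  | succ k ih =>
    rcases ih with ⟨t, P, h1, h2⟩ | ⟨P, h1, h2, h3⟩
    · exact Or.inl ⟨t, P, ⟨by have := h1.1; omega, h1.2⟩, h2⟩
    · by_cases hC : ∀ t, ((CC S col t (P t)).card : ℝ) < κ * S.card
      · right
        obtain ⟨P', q1, q2, q3⟩ := greedy_step col P h1 h2 hl hl' hC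
        refine ⟨P', q1, q2, ?_⟩
        rw [Nat.succ_mul]; omega
      · left
        push Not at hC
        obtain ⟨t, ht⟩ := hC
        exact ⟨t, P t, ⟨by have := (h1 t).1; omega, (h1 t).2⟩, ht⟩

theorem finite_lemma (κ : ℝ) (hκ : κ < 1 / 3) : ∃ M s0 : ℕ, ∀ (c : Sym2 ℕ+ → Fin 4)
    (S : Finset ℕ+) (col : ℕ+ → Fin 4), s0 ≤ S.card →
    ∃ t P, Fam c S M t P ∧ κ * S.card ≤ ((CC S col t P).card : ℝ) := by
  set η : ℝ := (3 - 9 * κ) / 48 with hη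
  have hη0 : 0 < η := by rw [hη]; apply div_pos <;> linarith
  obtain ⟨M, hM⟩ := exists_nat_gt (8 / η)
  obtain ⟨s0, hs0⟩ := exists_nat_gt (2 / η)
  refine ⟨M, s0 + 1, fun c S col hS => ?_⟩
  have hSr : (s0 : ℝ) + 1 ≤ S.card := by exact_mod_cast hS
  rw [div_lt_iff₀ hη0] at hM hs0
  have hηS : 2 < η * S.card := by nlinarith
  set l := ⌊η * S.card⌋₊ with hl
  have hl1 : (l : ℝ) ≤ η * S.card := Nat.floor_le (by linarith)
  have hl2 : η * S.card < l + 1 := Nat.lt_floor_add_one _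
  have hl3 : 1 ≤ l := by
    have : (1 : ℝ) < l := by linarith
    have : 1 < l := by exact_mod_cast this
    omega
  rcases greedy (c := c) (κ := κ) col hl3 (by
    have : (3 - 9 * κ) = 48 * η := by rw [hη]; ring
    rw [this]; linarith) M with h | ⟨P, h1, h2, h3⟩
  · exact h
  · exfalso
    have h4 : ∑ t, gg col t (P t) ≤ 4 * S.card := by
      calc _ ≤ ∑ _t : Fin 4, S.card := by
            refine Finset.sum_le_sum fun t _ => Finset.card_le_card ?_
            intro x hx
            exact (h1 t).2.2.2 x (by simpa [vx] using (Finset.mem_filter.1 hx).1)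
        _ = _ := by simp
    have h5 : (M : ℝ) * l ≤ 4 * S.card := by exact_mod_cast h3.trans h4
    have h6 : η * S.card / 2 < l := by linarith
    have hS0 : (0 : ℝ) < S.card := by have := (Nat.cast_nonneg s0 : (0 : ℝ) ≤ s0); linarith
    have hM0 : (0 : ℝ) < M := by
      rcases Nat.eq_zero_or_pos M with e | e
      · rw [e] at hM; norm_num at hM
      · exact_mod_cast e
    have h7 : (M : ℝ) * (η * S.card / 2) < M * l := mul_lt_mul_of_pos_left h6 hM0
    nlinarith

/-! ### Four constant ultrafilters -/

/-- the block condition used in `build_path` -/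
def BlockCond (c : Sym2 ℕ+ → Fin 4) (t : Fin 4) (K : Set ℕ+) (κ : ℝ) (N : ℕ) : Prop :=
  ∃ n : ℕ, N ≤ n ∧ 0 < n ∧ ∃ B : List (List ℕ+), (∀ b ∈ B, IsBlock c t K b) ∧ B.flatten.Nodup ∧
    (∀ x ∈ B.flatten, N < (x : ℕ)) ∧
    κ * n ≤ (B.flatten.filter (fun x : ℕ+ => (x : ℕ) ≤ n)).length

theorem case_four {c : Sym2 ℕ+ → Fin 4} {κ κ' : ℝ} (hκ : 0 < κ) (hκκ : κ < κ') (hκ' : κ' < 1 / 3)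
    (h : ∀ t, ∃ U : NPU, ∀ W, LL c t W ∈ U.1) :
    ∃ (i : Fin 4) (P : Set ℕ+), IsMonoPath completeAdj c i P ∧ κ ≤ upperDensity P := by
  classical
  choose U hU using h
  let W0 : NPU := U 0
  choose col hcol using LL_exists c W0
  have hcol' : ∀ x t, col x = t → x ∈ LL c t W0 := by
    rintro x t rfl; exact hcol x
  obtain ⟨M, s0, hFL⟩ := finite_lemma κ' hκ'
  have hN : ∀ N, ∃ t, BlockCond c t (LL c t W0) κ N := by
    intro N
    choose N' hNN' hatt using fun t => attach_blocks (hU t) W0 M N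
    let N1 := ∑ t, N' t
    have hN1 : ∀ t, N' t ≤ N1 := fun t =>
      Finset.single_le_sum (f := N') (fun _ _ => Nat.zero_le _) (Finset.mem_univ t)
    have hNN1 : N ≤ N1 := (hNN' 0).trans (hN1 0)
    obtain ⟨m, hm⟩ := exists_nat_gt (κ' * N1 / (κ' - κ))
    rw [div_lt_iff₀ (by linarith)] at hm
    let n := N1 + s0 + m + 1
    let S : Finset ℕ+ := seg n \ seg N1
    have hmS : ∀ x, x ∈ S ↔ (x : ℕ) ≤ n ∧ N1 < (x : ℕ) := by
      intro x; simp [S, mem_seg]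
    have hScard : n - N1 ≤ S.card := by
      have := Finset.le_card_sdiff (seg N1) (seg n)
      rw [card_seg, card_seg] at this
      exact this
    obtain ⟨t, P, ⟨p1, p2, p3, p4⟩, hCC⟩ := hFL c S col (by omega)
    obtain ⟨B, b1, b2, b3, b4, b5⟩ := hatt t P p1 p2 (by
      intro p hp x hx
      have := (hmS x).1 (p4 x (List.mem_flatten.2 ⟨p, hp, hx⟩))
      have := hN1 t
      omega) p3
    let D : Finset ℕ+ := S.filter (fun x => col x = t ∧ x ∉ P.flatten)
    have hDfl : (D.toList.map (fun x => [x])).flatten = D.toList := by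
      rw [← List.flatMap_def]; simp
    refine ⟨t, n, by omega, by omega, B ++ D.toList.map (fun x => [x]), ?_, ?_, ?_, ?_⟩
    · intro b hb
      rcases List.mem_append.1 hb with hb | hb
      · exact b1 b hb
      · obtain ⟨x, hx, rfl⟩ := List.mem_map.1 hb
        rw [Finset.mem_toList, Finset.mem_filter] at hx
        have := hcol' x t hx.2.1
        exact ⟨by simp, ⟨x, this, rfl⟩, ⟨x, this, rfl⟩⟩
    · rw [List.flatten_append, hDfl, List.nodup_append]
      refine ⟨b2, D.nodup_toList, ?_⟩
      rintro a ha b hb rfl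
      rw [Finset.mem_toList, Finset.mem_filter] at hb
      rcases b5 a ha with e | e
      · exact hb.2.2 e
      · have := (hmS a).1 hb.1
        have := hN1 t
        omega
    · intro x hx
      rw [List.flatten_append, hDfl, List.mem_append] at hx
      rcases hx with hx | hx
      · exact b3 x hx
      · rw [Finset.mem_toList, Finset.mem_filter] at hx
        have := (hmS x).1 hx.1
        omega
    · have hle : (CC S col t P).card ≤
          ((B ++ D.toList.map (fun x => [x])).flatten.filter
            (fun x : ℕ+ => (x : ℕ) ≤ n)).length := by
        refine le_trans (Finset.card_le_card ?_) (List.toFinset_card_le _)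
        intro x hx
        rw [List.mem_toFinset, List.mem_filter, List.flatten_append, hDfl, List.mem_append,
          Finset.mem_toList]
        have hxS : x ∈ S := by
          rcases Finset.mem_union.1 hx with hx | hx
          · exact (Finset.mem_filter.1 hx).1
          · exact p4 x (by simpa [vx] using hx)
        refine ⟨?_, by simpa using ((hmS x).1 hxS).1⟩
        by_cases hxP : x ∈ P.flatten
        · exact Or.inl (b4 x hxP)
        · right
          rcases Finset.mem_union.1 hx with hx | hx
          · exact Finset.mem_filter.2 ⟨hxS, (Finset.mem_filter.1 hx).2, hxP⟩
          · exact absurd (by simpa [vx] using hx) hxP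
      have hle' : ((CC S col t P).card : ℝ) ≤
          ((B ++ D.toList.map (fun x => [x])).flatten.filter
            (fun x : ℕ+ => (x : ℕ) ≤ n)).length := by exact_mod_cast hle
      refine le_trans ?_ (hCC.trans hle')
      have e1 : (n : ℝ) - N1 ≤ S.card := by
        have : n ≤ S.card + N1 := by omega
        have : (n : ℝ) ≤ S.card + N1 := by exact_mod_cast this
        linarith
      have e2 : (m : ℝ) ≤ n := by exact_mod_cast (show m ≤ n by omega)
      have e3 : κ' * ((n : ℝ) - N1) ≤ κ' * S.card := mul_le_mul_of_nonneg_left e1 (by linarith)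
      nlinarith
  have hmono : ∀ t N N', N ≤ N' → BlockCond c t (LL c t W0) κ N' →
      BlockCond c t (LL c t W0) κ N := by
    rintro t N N' hNN ⟨n, h1, h2, B, h3, h4, h5, h6⟩
    exact ⟨n, hNN.trans h1, h2, B, h3, h4, fun x hx => lt_of_le_of_lt hNN (h5 x hx), h6⟩
  have ht : ∃ t, ∀ N, BlockCond c t (LL c t W0) κ N := by
    by_contra hx
    push Not at hx
    choose g hg using hx
    obtain ⟨t, ht⟩ := hN (∑ t, g t)
    exact hg t (hmono t _ _ (Finset.single_le_sum (f := g) (fun _ _ => Nat.zero_le _)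
      (Finset.mem_univ t)) ht)
  obtain ⟨t, ht⟩ := ht
  exact ⟨t, build_path (LL_linked W0) hκ ht⟩

theorem main_small (c : Sym2 ℕ+ → Fin 4) {κ κ' : ℝ} (hκ : 0 < κ) (hκκ : κ < κ')
    (hκ' : κ' < 1 / 3) :
    ∃ (i : Fin 4) (P : Set ℕ+), IsMonoPath completeAdj c i P ∧ κ ≤ upperDensity P := by
  by_cases hsp : SparseH c κ'
  · by_cases hT : ∀ t, ∃ U, ∀ j, j ≠ t → (sysOf c).cls j U = none
    · refine case_four hκ hκκ hκ' fun t => ?_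
      obtain ⟨U, hU⟩ := hT t
      refine ⟨U, fun W => ?_⟩
      have h1 : cc c U W = t := by
        by_contra hx
        obtain ⟨q, hq⟩ := (sysOf c).a1 U W
        rw [show (sysOf c).c U W = cc c U W from rfl, hU _ hx] at hq
        exact absurd hq (by simp)
      have := cc_spec c U W
      rwa [h1] at this
    · exfalso
      obtain ⟨T, K, h1, h2, h3⟩ := (sysOf c).trichotomy (sysOf_a4 c)
        (fun hc => cover_false (hκ.trans hκκ) hκ' hsp hc) hT
      exact allgood_false (hκ.trans hκκ) hκ' hsp T K h1 h2 h3
  · exact of_not_sparse hκ hκκ hsp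

/-- In any 4-edge-colouring of `K_ℕ`, for every `ε > 0` there is a
monochromatic path of upper density at least `1/3 - ε`. -/
theorem stmt_1 (c : Sym2 ℕ+ → Fin 4) (ε : ℝ) (hε : 0 < ε) :
    ∃ (i : Fin 4) (P : Set ℕ+),
      IsMonoPath completeAdj c i P ∧ 1 / 3 - ε ≤ upperDensity P := by
  obtain ⟨i, P, h1, h2⟩ := main_small c (κ := 1 / 3 - min ε (1 / 4))
    (κ' := 1 / 3 - min ε (1 / 4) / 2) (by have := min_le_right ε (1 / 4); linarith)
    (by have : 0 < min ε (1 / 4) := lt_min hε (by norm_num)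
        linarith)
    (by have : 0 < min ε (1 / 4) := lt_min hε (by norm_num)
        linarith)
  exact ⟨i, P, h1, le_trans (by have := min_le_left ε (1 / 4); linarith) h2⟩
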